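/- arXiv:2306.11178 — 5 statements merged into one kernel-verified Lean document; each statement's English description precedes it below -/
import Mathlib

section
/- Let a, b, c > 0 and let D = {x ∈ ℝ³ : x₁²/a² + x₂²/b² + x₃²/c² ≤ 1} be the solid ellipsoid with semi-axes a, b, c. Then for every x ∈ D, the Newtonian potential satisfies ∫_D |x−y|⁻¹ dy = L₀(a,b,c) − L₁(a,b,c)x₁² − L₂(a,b,c)x₂² − L₃(a,b,c)x₃², where L₀(a,b,c) = πabc ∫₀^∞ ds/√((a²+s)(b²+s)(c²+s)), L₁(a,b,c) = πabc ∫₀^∞ ds/((a²+s)√((a²+s)(b²+s)(c²+s))), L₂(a,b,c) = πabc ∫₀^∞ ds/((b²+s)√((a²+s)(b²+s)(c²+s))), and L₃(a,b,c) = πabc ∫₀^∞ ds/((c²+s)√((a²+s)(b²+s)(c²+s))). -/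
open MeasureTheory Real

/-- `L₀(a,b,c) = πabc ∫₀^∞ ds/√((a²+s)(b²+s)(c²+s))`. -/
noncomputable def ellipL0 (a b c : ℝ) : ℝ :=
  π * a * b * c * ∫ s in Set.Ioi (0:ℝ), 1 / Real.sqrt ((a^2+s)*(b^2+s)*(c^2+s))

/-- `L₁(a,b,c) = πabc ∫₀^∞ ds/((a²+s)√((a²+s)(b²+s)(c²+s)))`. -/
noncomputable def ellipL1 (a b c : ℝ) : ℝ :=
  π * a * b * c * ∫ s in Set.Ioi (0:ℝ), 1 / ((a^2+s) * Real.sqrt ((a^2+s)*(b^2+s)*(c^2+s)))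

/-- `L₂(a,b,c) = πabc ∫₀^∞ ds/((b²+s)√((a²+s)(b²+s)(c²+s)))`. -/
noncomputable def ellipL2 (a b c : ℝ) : ℝ :=
  π * a * b * c * ∫ s in Set.Ioi (0:ℝ), 1 / ((b^2+s) * Real.sqrt ((a^2+s)*(b^2+s)*(c^2+s)))

/-- `L₃(a,b,c) = πabc ∫₀^∞ ds/((c²+s)√((a²+s)(b²+s)(c²+s)))`. -/
noncomputable def ellipL3 (a b c : ℝ) : ℝ :=
  π * a * b * c * ∫ s in Set.Ioi (0:ℝ), 1 / ((c^2+s) * Real.sqrt ((a^2+s)*(b^2+s)*(c^2+s)))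

/-- Integration in polar coordinates for the lower Lebesgue integral. -/
theorem lintegral_eq_lintegral_toSphere_lintegral_Ioi {E : Type*} [NormedAddCommGroup E]
    [NormedSpace ℝ E] [MeasurableSpace E] [BorelSpace E] [FiniteDimensional ℝ E] [Nontrivial E]
    (μ : Measure E) [μ.IsAddHaarMeasure] {f : E → ENNReal} (hf : Measurable f) :
    ∫⁻ x, f x ∂μ = ∫⁻ θ : Metric.sphere (0 : E) 1, (∫⁻ r in Set.Ioi (0 : ℝ),
      ENNReal.ofReal (r ^ (Module.finrank ℝ E - 1)) * f (r • (θ : E))) ∂μ.toSphere := by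
  have hsub : MeasurableSet ({(0 : E)}ᶜ) := (measurableSet_singleton _).compl
  have hmeas : Measurable fun q : Metric.sphere (0 : E) 1 × Set.Ioi (0 : ℝ) ↦
      f ((q.2 : ℝ) • (q.1 : E)) := hf.comp (by fun_prop)
  calc
    ∫⁻ x, f x ∂μ = ∫⁻ x : ({(0)}ᶜ : Set E), f x ∂(μ.comap (↑)) := by
      rw [lintegral_subtype_comap hsub, restrict_compl_singleton]
    _ = ∫⁻ q : Metric.sphere (0 : E) 1 × Set.Ioi (0 : ℝ), f ((q.2 : ℝ) • (q.1 : E))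
          ∂μ.toSphere.prod (.volumeIoiPow (Module.finrank ℝ E - 1)) := by
      rw [← (μ.measurePreserving_homeomorphUnitSphereProd).lintegral_comp hmeas]
      refine lintegral_congr fun x ↦ ?_
      have hx : ‖(x : E)‖ ≠ 0 := norm_ne_zero_iff.2 x.2
      simp [smul_smul, hx]
    _ = _ := by
      rw [lintegral_prod _ hmeas.aemeasurable]
      refine lintegral_congr fun θ ↦ ?_
      have hθ : Measurable fun r : ℝ ↦ f (r • (θ : E)) := hf.comp (by fun_prop)
      rw [Measure.volumeIoiPow]
      refine (lintegral_withDensity_eq_lintegral_mul _ (by fun_prop)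
        (hθ.comp measurable_subtype_coe)).trans ?_
      exact lintegral_subtype_comap measurableSet_Ioi
        fun r : ℝ ↦ ENNReal.ofReal (r ^ (Module.finrank ℝ E - 1)) * f (r • (θ : E))

theorem integrable_pow_mul_exp_neg_mul_sq {p : ℝ} (hp : 0 < p) (n : ℕ) :
    Integrable fun x : ℝ ↦ x ^ n * exp (-p * x ^ 2) := by
  simpa using integrable_rpow_mul_exp_neg_mul_sq hp (s := n) (by linarith [n.cast_nonneg (α := ℝ)])

theorem integral_mul_exp_neg_mul_sq {p : ℝ} (hp : 0 < p) :
    ∫ x : ℝ, x * exp (-p * x ^ 2) = 0 := by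
  have h := integral_eq_zero_of_hasDerivAt_of_integrable
    (f := fun x : ℝ ↦ (-2 * p)⁻¹ * exp (-p * x ^ 2)) (f' := fun x : ℝ ↦ x * exp (-p * x ^ 2))
    (fun x ↦ ((((hasDerivAt_pow 2 x).const_mul (-p)).exp).const_mul (-2 * p)⁻¹).congr_deriv (by
      push_cast
      field_simp))
    (by simpa using integrable_pow_mul_exp_neg_mul_sq hp 1)
    ((integrable_exp_neg_mul_sq hp).const_mul _)
  exact h

theorem integral_sq_mul_exp_neg_mul_sq {p : ℝ} (hp : 0 < p) :
    ∫ x : ℝ, x ^ 2 * exp (-p * x ^ 2) = √(π / p) / (2 * p) := by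
  have h := integral_eq_zero_of_hasDerivAt_of_integrable
    (f := fun x : ℝ ↦ x * exp (-p * x ^ 2))
    (f' := fun x : ℝ ↦ exp (-p * x ^ 2) - 2 * p * (x ^ 2 * exp (-p * x ^ 2)))
    (fun x ↦ ((hasDerivAt_id' x).mul ((hasDerivAt_pow 2 x).const_mul (-p)).exp).congr_deriv (by
      push_cast
      ring))
    ((integrable_exp_neg_mul_sq hp).sub ((integrable_pow_mul_exp_neg_mul_sq hp 2).const_mul _))
    (by simpa using integrable_pow_mul_exp_neg_mul_sq hp 1)
  rw [integral_sub (integrable_exp_neg_mul_sq hp)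
    ((integrable_pow_mul_exp_neg_mul_sq hp 2).const_mul _), integral_const_mul,
    integral_gaussian] at h
  rw [eq_div_iff (by positivity)]
  linarith

/-- Gaussian integrals of monomials on Euclidean space. -/
theorem integral_prod_pow_mul_exp_neg_mul_sq {ι : Type*} [Fintype ι] {p : ι → ℝ}
    (hp : ∀ i, 0 < p i) (n : ι → ℕ) :
    Integrable (fun y : EuclideanSpace ℝ ι ↦ ∏ i, y i ^ n i * exp (-p i * y i ^ 2)) ∧
    ∫ y : EuclideanSpace ℝ ι, ∏ i, y i ^ n i * exp (-p i * y i ^ 2) =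
      ∏ i, ∫ x : ℝ, x ^ n i * exp (-p i * x ^ 2) := by
  have hv := EuclideanSpace.volume_preserving_symm_measurableEquiv_toLp ι
  constructor
  · have h := Integrable.fintype_prod (μ := fun _ : ι ↦ (volume : Measure ℝ))
      (f := fun i (x : ℝ) ↦ x ^ n i * exp (-p i * x ^ 2))
      fun i ↦ integrable_pow_mul_exp_neg_mul_sq (hp i) (n i)
    exact hv.integrable_comp_of_integrable h
  · rw [← integral_fintype_prod_volume_eq_prod fun i (x : ℝ) ↦ x ^ n i * exp (-p i * x ^ 2)]
    exact hv.integral_comp' fun y : ι → ℝ ↦ ∏ i, y i ^ n i * exp (-p i * y i ^ 2)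

theorem integral_sq_add_const_mul_exp {p : Fin 3 → ℝ} (hp : ∀ i, 0 < p i) (u : Fin 3 → ℝ) (c : ℝ) :
    Integrable (fun y : EuclideanSpace ℝ (Fin 3) ↦
      ((∑ i, u i * y i) ^ 2 + c) * exp (-∑ i, p i * y i ^ 2)) ∧
    ∫ y : EuclideanSpace ℝ (Fin 3), ((∑ i, u i * y i) ^ 2 + c) * exp (-∑ i, p i * y i ^ 2) =
      (∑ i, u i ^ 2 / (2 * p i) + c) * ∏ i, √(π / p i) := by
  have key (n : Fin 3 → ℕ) := integral_prod_pow_mul_exp_neg_mul_sq hp n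
  have h00 := key ![2, 0, 0]
  have h11 := key ![0, 2, 0]
  have h22 := key ![0, 0, 2]
  have h01 := key ![1, 1, 0]
  have h02 := key ![1, 0, 1]
  have h12 := key ![0, 1, 1]
  have h0 := key ![0, 0, 0]
  simp only [Fin.prod_univ_three, Matrix.cons_val, pow_zero, pow_one, one_mul,
    integral_sq_mul_exp_neg_mul_sq, integral_mul_exp_neg_mul_sq, hp,
    integral_gaussian, mul_zero, zero_mul] at h00 h11 h22 h01 h02 h12 h0
  have hadd {f g : EuclideanSpace ℝ (Fin 3) → ℝ} {v w : ℝ} (hf : Integrable f ∧ ∫ y, f y = v)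
      (hg : Integrable g ∧ ∫ y, g y = w) :
      Integrable (fun y ↦ f y + g y) ∧ ∫ y, (f y + g y) = v + w :=
    ⟨hf.1.add hg.1, by rw [integral_add hf.1 hg.1, hf.2, hg.2]⟩
  have hmul {f : EuclideanSpace ℝ (Fin 3) → ℝ} {v : ℝ} (k : ℝ)
      (hf : Integrable f ∧ ∫ y, f y = v) :
      Integrable (fun y ↦ k * f y) ∧ ∫ y, k * f y = k * v :=
    ⟨hf.1.const_mul k, by rw [integral_const_mul, hf.2]⟩
  have H := hadd (hmul (u 0 ^ 2) h00) <| hadd (hmul (u 1 ^ 2) h11) <|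
    hadd (hmul (u 2 ^ 2) h22) <| hadd (hmul (2 * u 0 * u 1) h01) <|
    hadd (hmul (2 * u 0 * u 2) h02) <| hadd (hmul (2 * u 1 * u 2) h12) (hmul c h0)
  convert H using 3
  on_goal 2 => ext y
  all_goals simp only [Fin.sum_univ_three, Fin.prod_univ_three, neg_add, exp_add, neg_mul]
  all_goals ring

/-- `∫ r dr` over the positive part of `{A r² + 2 B r + C ≤ 0}`. -/
theorem lintegral_Ioi_ofReal_mul_indicator_quadratic {A B C : ℝ} (hA : 0 < A) (hC : C ≤ 0) :
    ∫⁻ r in Set.Ioi (0 : ℝ), ENNReal.ofReal r *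
      {r : ℝ | A * r ^ 2 + 2 * B * r + C ≤ 0}.indicator 1 r =
      ENNReal.ofReal (((-B + √(B ^ 2 - A * C)) / A) ^ 2 / 2) := by
  have hd : 0 ≤ B ^ 2 - A * C := by nlinarith [sq_nonneg B]
  set d := √(B ^ 2 - A * C) with hd_def
  have hdd : d ^ 2 = B ^ 2 - A * C := sq_sqrt hd
  have hdB : |B| ≤ d := abs_le_sqrt (by nlinarith)
  obtain ⟨hB1, hB2⟩ := abs_le.1 hdB
  have hρ : 0 ≤ (-B + d) / A := div_nonneg (by linarith) hA.le
  have hset (r : ℝ) (hr : 0 < r) : A * r ^ 2 + 2 * B * r + C ≤ 0 ↔ r ≤ (-B + d) / A := by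
    rw [le_div_iff₀ hA]
    have hfac : A * (A * r ^ 2 + 2 * B * r + C) = (r * A - (-B + d)) * (r * A + B + d) := by
      linear_combination hdd
    have hpos : 0 < r * A + B + d := by nlinarith [mul_pos hr hA]
    constructor <;> intro h <;> by_contra! h'
    · nlinarith [mul_pos (sub_pos.2 h') hpos]
    · nlinarith [mul_pos hA h']
  calc
    _ = ∫⁻ r in Set.Ioi (0 : ℝ), (Set.Ioc 0 ((-B + d) / A)).indicator ENNReal.ofReal r := by
      refine setLIntegral_congr_fun measurableSet_Ioi fun r hr ↦ ?_
      by_cases h : r ≤ (-B + d) / A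
      · simp [Set.indicator, hset r hr, h, Set.mem_Ioi.1 hr]
      · simp [Set.indicator, hset r hr, h]
    _ = ∫⁻ r in Set.Ioc 0 ((-B + d) / A), ENNReal.ofReal r := by
      rw [lintegral_indicator measurableSet_Ioc, Measure.restrict_restrict measurableSet_Ioc,
        Set.inter_eq_left.2 Set.Ioc_subset_Ioi_self]
    _ = _ := by
      rw [← ofReal_integral_eq_lintegral_ofReal (intervalIntegral.intervalIntegrable_id).1,
        ← intervalIntegral.integral_of_le hρ, integral_id]
      · simp
      · filter_upwards [ae_restrict_mem measurableSet_Ioc] with r hr using hr.1.le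

theorem sq_roots_add {A B C : ℝ} (hA : 0 < A) (hC : C ≤ 0) :
    ENNReal.ofReal (((-B + √(B ^ 2 - A * C)) / A) ^ 2 / 2) +
      ENNReal.ofReal (((B + √(B ^ 2 - A * C)) / A) ^ 2 / 2) =
      ENNReal.ofReal ((2 * B ^ 2 - A * C) / A ^ 2) := by
  have hd : 0 ≤ B ^ 2 - A * C := by nlinarith [sq_nonneg B]
  rw [← ENNReal.ofReal_add (by positivity) (by positivity)]
  congr 1
  field_simp
  linear_combination 2 * sq_sqrt hd

theorem lintegral_Ioi_ofReal_exp_neg_sq :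
    ∫⁻ r in Set.Ioi (0 : ℝ), ENNReal.ofReal (exp (-r ^ 2)) = ENNReal.ofReal (√π / 2) := by
  rw [← ofReal_integral_eq_lintegral_ofReal]
  · simpa using congrArg ENNReal.ofReal (integral_gaussian_Ioi 1)
  · simpa [IntegrableOn] using (integrable_exp_neg_mul_sq one_pos).integrableOn (s := Set.Ioi 0)
  · exact .of_forall fun _ ↦ (exp_pos _).le

/-- The Laplace transform of an affine function. -/
theorem lintegral_Ioi_affine_mul_exp {A B C : ℝ} (hA : 0 < A) (hC : C ≤ 0) :
    ∫⁻ t in Set.Ioi (0 : ℝ), ENNReal.ofReal ((2 * B ^ 2 * t - C) * exp (-(t * A))) =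
      ENNReal.ofReal ((2 * B ^ 2 - A * C) / A ^ 2) := by
  have h0 := integrableOn_rpow_mul_exp_neg_mul_rpow (s := 0) (p := 1) (by norm_num) one_pos hA
  have h1 := integrableOn_rpow_mul_exp_neg_mul_rpow (s := 1) (p := 1) (by norm_num) one_pos hA
  have e0 := integral_rpow_mul_exp_neg_mul_rpow (q := 0) (p := 1) one_pos (by norm_num) hA
  have e1 := integral_rpow_mul_exp_neg_mul_rpow (q := 1) (p := 1) one_pos (by norm_num) hA
  norm_num at h0 h1 e0 e1
  have e : (fun t : ℝ ↦ (2 * B ^ 2 * t - C) * exp (-(t * A))) =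
      fun t ↦ 2 * B ^ 2 * (t * exp (-(A * t))) - C * exp (-(A * t)) := by
    ext t
    rw [mul_comm A t]
    ring
  rw [← ofReal_integral_eq_lintegral_ofReal]
  · rw [e, integral_sub (h1.const_mul _) (h0.const_mul _), integral_const_mul, integral_const_mul,
      e0, e1]
    congr 1
    simp [rpow_neg hA.le]
    field_simp
  · rw [e]
    exact (h1.const_mul _).sub (h0.const_mul _)
  · filter_upwards [ae_restrict_mem measurableSet_Ioi] with t ht
    have : 0 ≤ 2 * B ^ 2 * t := by have := Set.mem_Ioi.1 ht; positivity
    exact mul_nonneg (by linarith) (exp_pos _).le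

section

variable (s : Fin 3 → ℝ) (x : EuclideanSpace ℝ (Fin 3))

/-- Twice the mean of the squared distances from `x` to the ellipsoid `∑ i, z i ^ 2 / s i = 1`
in the directions `y` and `-y`, for a unit vector `y`. -/
noncomputable def chordDensity (y : EuclideanSpace ℝ (Fin 3)) : ℝ :=
  (2 * (∑ i, x i * y i / s i) ^ 2 - (∑ i, y i ^ 2 / s i) * (∑ i, x i ^ 2 / s i - 1)) /
    (∑ i, y i ^ 2 / s i) ^ 2

theorem measurable_chordDensity : Measurable (chordDensity s x) := by
  unfold chordDensity
  fun_prop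

theorem chordDensity_smul {r : ℝ} (hr : r ≠ 0) (y : EuclideanSpace ℝ (Fin 3)) :
    r ^ 2 * chordDensity s x (r • y) = chordDensity s x y := by
  have h1 : ∑ i, x i * (r • y) i / s i = r * ∑ i, x i * y i / s i := by
    rw [Finset.mul_sum]
    exact Finset.sum_congr rfl fun i _ ↦ by rw [PiLp.smul_apply, smul_eq_mul]; ring
  have h2 : ∑ i, (r • y) i ^ 2 / s i = r ^ 2 * ∑ i, y i ^ 2 / s i := by
    rw [Finset.mul_sum]
    exact Finset.sum_congr rfl fun i _ ↦ by rw [PiLp.smul_apply, smul_eq_mul]; ring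
  simp only [chordDensity, h1, h2]
  rw [show ∀ B A C : ℝ, 2 * (r * B) ^ 2 - r ^ 2 * A * C = r ^ 2 * (2 * B ^ 2 - A * C) by
    intros; ring, mul_pow, ← pow_mul, mul_div_mul_comm, ← mul_assoc]
  field_simp

variable {s x}

theorem sum_sq_div_pos (hs : ∀ i, 0 < s i) {y : EuclideanSpace ℝ (Fin 3)} (hy : y ≠ 0) :
    0 < ∑ i, y i ^ 2 / s i := by
  have hnn (i : Fin 3) : 0 ≤ y i ^ 2 / s i := div_nonneg (sq_nonneg _) (hs i).le
  refine (Finset.sum_nonneg fun i _ ↦ hnn i).lt_of_ne' fun h ↦ hy ?_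
  rw [Finset.sum_eq_zero_iff_of_nonneg fun i _ ↦ hnn i] at h
  ext i
  simpa [(hs i).ne'] using h i (Finset.mem_univ i)

theorem lintegral_ray_add_lintegral_ray (hs : ∀ i, 0 < s i) (hx : ∑ i, x i ^ 2 / s i ≤ 1)
    {y : EuclideanSpace ℝ (Fin 3)} (hy : ‖y‖ = 1) :
    ∫⁻ r in Set.Ioi (0 : ℝ), ENNReal.ofReal (r ^ 2) *
      ({z : EuclideanSpace ℝ (Fin 3) | ∑ i, z i ^ 2 / s i ≤ 1}.indicator
          (fun z ↦ ENNReal.ofReal (1 / ‖x - z‖)) (x + r • y) +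
        {z : EuclideanSpace ℝ (Fin 3) | ∑ i, z i ^ 2 / s i ≤ 1}.indicator
          (fun z ↦ ENNReal.ofReal (1 / ‖x - z‖)) (x - r • y)) =
      ENNReal.ofReal (chordDensity s x y) := by
  set A := ∑ i, y i ^ 2 / s i with hA_def
  set B := ∑ i, x i * y i / s i with hB_def
  set C := ∑ i, x i ^ 2 / s i - 1 with hC_def
  have hA : 0 < A := sum_sq_div_pos hs (by rintro rfl; simp at hy)
  have hC : C ≤ 0 := by linarith
  have hadd (r : ℝ) : ∑ i, (x + r • y) i ^ 2 / s i ≤ 1 ↔ A * r ^ 2 + 2 * B * r + C ≤ 0 := by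
    rw [← sub_nonpos, hA_def, hB_def, hC_def]
    simp only [Fin.sum_univ_three, PiLp.add_apply, PiLp.smul_apply, smul_eq_mul]
    ring_nf
  have hsub (r : ℝ) : ∑ i, (x - r • y) i ^ 2 / s i ≤ 1 ↔ A * r ^ 2 + 2 * -B * r + C ≤ 0 := by
    rw [← sub_nonpos, hA_def, hB_def, hC_def]
    simp only [Fin.sum_univ_three, PiLp.sub_apply, PiLp.smul_apply, smul_eq_mul]
    ring_nf
  have hrr {r : ℝ} (hr : 0 < r) : ENNReal.ofReal (r ^ 2) * ENNReal.ofReal (1 / r) =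
      ENNReal.ofReal r := by
    rw [← ENNReal.ofReal_mul (by positivity)]
    congr 1
    field_simp
  have hmeas (B : ℝ) : Measurable fun r : ℝ ↦ ENNReal.ofReal r *
      {r : ℝ | A * r ^ 2 + 2 * B * r + C ≤ 0}.indicator 1 r :=
    ENNReal.measurable_ofReal.mul (measurable_one.indicator
      (measurableSet_le (by fun_prop) measurable_const))
  calc
    _ = ∫⁻ r in Set.Ioi (0 : ℝ),
        (ENNReal.ofReal r * {r : ℝ | A * r ^ 2 + 2 * B * r + C ≤ 0}.indicator 1 r +
          ENNReal.ofReal r * {r : ℝ | A * r ^ 2 + 2 * -B * r + C ≤ 0}.indicator 1 r) := by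
      refine setLIntegral_congr_fun measurableSet_Ioi fun r (hr : 0 < r) ↦ ?_
      simp only [Set.indicator, Set.mem_ofPred_eq, hadd, hsub, mul_add]
      congr 1 <;> split_ifs <;> simp [norm_smul, hy, abs_of_pos hr, ← hrr hr]
    _ = _ := by
      rw [lintegral_add_left (hmeas B), lintegral_Ioi_ofReal_mul_indicator_quadratic hA hC,
        lintegral_Ioi_ofReal_mul_indicator_quadratic hA hC, neg_neg, neg_sq, sq_roots_add hA hC]
      rfl

theorem lintegral_ray_exp_mul_chordDensity {y : EuclideanSpace ℝ (Fin 3)} (hy : ‖y‖ = 1) :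
    ∫⁻ r in Set.Ioi (0 : ℝ), ENNReal.ofReal (r ^ 2) *
      ENNReal.ofReal (exp (-‖r • y‖ ^ 2) * chordDensity s x (r • y)) =
      ENNReal.ofReal (√π / 2) * ENNReal.ofReal (chordDensity s x y) := by
  rw [← lintegral_Ioi_ofReal_exp_neg_sq, ← lintegral_mul_const _ (by fun_prop)]
  refine setLIntegral_congr_fun measurableSet_Ioi fun r (hr : 0 < r) ↦ ?_
  rw [← ENNReal.ofReal_mul (by positivity), ← ENNReal.ofReal_mul (by positivity),
    ← chordDensity_smul s x hr.ne' y]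
  simp only [norm_smul, hy, mul_one, norm_eq_abs, sq_abs]
  congr 1
  ring

/-- The Newtonian potential of an ellipsoid as a Gaussian integral. -/
theorem sqrt_pi_mul_lintegral_one_div_norm_sub (hs : ∀ i, 0 < s i)
    (hx : ∑ i, x i ^ 2 / s i ≤ 1) :
    ENNReal.ofReal √π * ∫⁻ y in {z : EuclideanSpace ℝ (Fin 3) | ∑ i, z i ^ 2 / s i ≤ 1},
      ENNReal.ofReal (1 / ‖x - y‖) =
      ∫⁻ y, ENNReal.ofReal (exp (-‖y‖ ^ 2) * chordDensity s x y) := by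
  have hD : MeasurableSet {z : EuclideanSpace ℝ (Fin 3) | ∑ i, z i ^ 2 / s i ≤ 1} :=
    measurableSet_le (by fun_prop) measurable_const
  rw [← lintegral_indicator hD]
  set g := {z : EuclideanSpace ℝ (Fin 3) | ∑ i, z i ^ 2 / s i ≤ 1}.indicator
    (fun z ↦ ENNReal.ofReal (1 / ‖x - z‖))
  have hg : Measurable g := Measurable.indicator (by fun_prop) hD
  have hga : Measurable fun z ↦ g (x + z) := hg.comp (by fun_prop)
  have hgs : Measurable fun z ↦ g (x - z) := hg.comp (by fun_prop)
  have hF := measurable_chordDensity s x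
  have h2 : 2 * ∫⁻ z, g z = ∫⁻ z, (g (x + z) + g (x - z)) := by
    rw [lintegral_add_left hga, lintegral_add_left_eq_self, lintegral_sub_left_eq_self, two_mul]
  have hpi : ENNReal.ofReal √π = ENNReal.ofReal (√π / 2) * 2 := by
    rw [← ENNReal.ofReal_ofNat, ← ENNReal.ofReal_mul (by positivity), div_mul_cancel₀ _ two_ne_zero]
  rw [hpi, mul_assoc, h2,
    lintegral_eq_lintegral_toSphere_lintegral_Ioi (f := fun z ↦ g (x + z) + g (x - z)) _
      (by fun_prop),
    lintegral_eq_lintegral_toSphere_lintegral_Ioi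
      (f := fun y ↦ ENNReal.ofReal (exp (-‖y‖ ^ 2) * chordDensity s x y)) _ (by fun_prop),
    finrank_euclideanSpace_fin,
    ← lintegral_const_mul' _ _ ENNReal.ofReal_ne_top]
  refine lintegral_congr fun θ ↦ ?_
  have hθ : ‖(θ : EuclideanSpace ℝ (Fin 3))‖ = 1 := by simp
  rw [lintegral_ray_exp_mul_chordDensity hθ, lintegral_ray_add_lintegral_ray hs hx hθ]

theorem lintegral_exp_mul_chordDensity (hs : ∀ i, 0 < s i) (hx : ∑ i, x i ^ 2 / s i ≤ 1) :
    ∫⁻ y, ENNReal.ofReal (exp (-‖y‖ ^ 2) * chordDensity s x y) =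
      ∫⁻ t in Set.Ioi (0 : ℝ), ENNReal.ofReal
        ((1 - ∑ i, x i ^ 2 / (s i + t)) * ∏ i, √(π / (1 + t / s i))) := by
  have hC : ∑ i, x i ^ 2 / s i - 1 ≤ 0 := by linarith
  calc
    _ = ∫⁻ y : EuclideanSpace ℝ (Fin 3), ∫⁻ t in Set.Ioi (0 : ℝ), ENNReal.ofReal
        (((∑ i, √(2 * t) * (x i / s i) * y i) ^ 2 + (1 - ∑ i, x i ^ 2 / s i)) *
          exp (-∑ i, (1 + t / s i) * y i ^ 2)) := by
      refine lintegral_congr_ae ?_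
      filter_upwards [compl_mem_ae_iff.2 (measure_singleton (0 : EuclideanSpace ℝ (Fin 3)))]
        with y hy
      have hA := sum_sq_div_pos hs hy
      rw [ENNReal.ofReal_mul (exp_pos _).le, chordDensity, ← lintegral_Ioi_affine_mul_exp hA hC,
        ← lintegral_const_mul' _ _ ENNReal.ofReal_ne_top]
      refine setLIntegral_congr_fun measurableSet_Ioi fun t (ht : 0 < t) ↦ ?_
      have h2t : √(2 * t) ^ 2 = 2 * t := sq_sqrt (by positivity)
      simp only
      rw [← ENNReal.ofReal_mul (exp_pos _).le, EuclideanSpace.real_norm_sq_eq, mul_left_comm,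
        ← exp_add]
      congr 2
      · simp only [Fin.sum_univ_three]
        linear_combination (-(x 0 * y 0 / s 0 + x 1 * y 1 / s 1 + x 2 * y 2 / s 2) ^ 2) * h2t
      · congr 1
        simp only [Fin.sum_univ_three]
        ring
    _ = ∫⁻ t in Set.Ioi (0 : ℝ), ∫⁻ y : EuclideanSpace ℝ (Fin 3), ENNReal.ofReal
        (((∑ i, √(2 * t) * (x i / s i) * y i) ^ 2 + (1 - ∑ i, x i ^ 2 / s i)) *
          exp (-∑ i, (1 + t / s i) * y i ^ 2)) :=
      lintegral_lintegral_swap (by fun_prop)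
    _ = _ := by
      refine setLIntegral_congr_fun measurableSet_Ioi fun t (ht : 0 < t) ↦ ?_
      have hp (i : Fin 3) : 0 < 1 + t / s i := by have := hs i; positivity
      obtain ⟨hi, he⟩ := integral_sq_add_const_mul_exp hp (fun i ↦ √(2 * t) * (x i / s i))
        (1 - ∑ i, x i ^ 2 / s i)
      simp only
      rw [← ofReal_integral_eq_lintegral_ofReal hi (.of_forall fun y ↦ mul_nonneg
        (add_nonneg (sq_nonneg _) (by linarith)) (exp_pos _).le), he]
      congr 2
      have hi (i : Fin 3) : (√(2 * t) * (x i / s i)) ^ 2 / (2 * (1 + t / s i)) =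
          x i ^ 2 / s i - x i ^ 2 / (s i + t) := by
        have h1 := hs i
        rw [mul_pow, sq_sqrt (by positivity)]
        field_simp
        ring
      simp only [hi, Finset.sum_sub_distrib]
      ring

end

theorem integrableOn_one_div_sqrt_prod {p q r : ℝ} (hp : 0 < p) (hq : 0 < q) (hr : 0 < r) :
    IntegrableOn (fun t : ℝ ↦ 1 / √((p + t) * (q + t) * (r + t))) (Set.Ioi 0) := by
  set m := min p (min q r)
  have hm : 0 < m := lt_min hp (lt_min hq hr)
  have hmp : m ≤ p := min_le_left _ _
  have hmq : m ≤ q := (min_le_right _ _).trans (min_le_left _ _)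
  have hmr : m ≤ r := (min_le_right _ _).trans (min_le_right _ _)
  refine (integrableOn_add_rpow_Ioi_of_lt (a := -(3 / 2)) (c := 0) (m := m) (by norm_num)
    (by linarith)).mono' (Measurable.aestronglyMeasurable (by fun_prop)) ?_
  filter_upwards [ae_restrict_mem measurableSet_Ioi] with t (ht : 0 < t)
  have hmt : 0 < t + m := by linarith
  rw [norm_of_nonneg (by positivity), rpow_neg hmt.le, one_div]
  gcongr
  calc
    (t + m) ^ (3 / 2 : ℝ) = √((t + m) * (t + m) * (t + m)) := by
      rw [sqrt_eq_rpow, ← pow_two, ← pow_succ, ← rpow_natCast_mul hmt.le]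
      norm_num
    _ ≤ √((p + t) * (q + t) * (r + t)) := by
      gcongr √(?_ * ?_ * ?_) <;> linarith

theorem integrableOn_one_div_add_mul_sqrt_prod {p q r k : ℝ} (hp : 0 < p) (hq : 0 < q)
    (hr : 0 < r) (hk : 0 < k) :
    IntegrableOn (fun t : ℝ ↦ 1 / ((k + t) * √((p + t) * (q + t) * (r + t)))) (Set.Ioi 0) := by
  refine ((integrableOn_one_div_sqrt_prod hp hq hr).const_mul k⁻¹).mono'
    (Measurable.aestronglyMeasurable (by fun_prop)) ?_
  filter_upwards [ae_restrict_mem measurableSet_Ioi] with t (ht : 0 < t)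
  rw [norm_of_nonneg (by positivity), one_div, one_div, mul_inv]
  gcongr
  linarith

/-- The Newtonian potential of the solid ellipsoid with semi-axes `a, b, c`, evaluated
inside the ellipsoid, is the quadratic polynomial
`L₀ − L₁ x₁² − L₂ x₂² − L₃ x₃²`. -/
theorem newtonian_potential_of_ellipsoid (a b c : ℝ) (ha : 0 < a) (hb : 0 < b) (hc : 0 < c)
    (D : Set (EuclideanSpace ℝ (Fin 3)))
    (hD : D = {x : EuclideanSpace ℝ (Fin 3) |
      (x 0)^2 / a^2 + (x 1)^2 / b^2 + (x 2)^2 / c^2 ≤ 1}) :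
    ∀ x ∈ D, (∫ y in D, 1 / ‖x - y‖) =
      ellipL0 a b c - ellipL1 a b c * (x 0)^2 - ellipL2 a b c * (x 1)^2
        - ellipL3 a b c * (x 2)^2 := by
  intro x hx
  subst hD
  set s : Fin 3 → ℝ := ![a ^ 2, b ^ 2, c ^ 2] with hs_def
  have hs : ∀ i, 0 < s i := by
    intro i
    fin_cases i <;> simp [hs_def] <;> positivity
  have hset : {x : EuclideanSpace ℝ (Fin 3) | (x 0)^2 / a^2 + (x 1)^2 / b^2 + (x 2)^2 / c^2 ≤ 1} =
      {z : EuclideanSpace ℝ (Fin 3) | ∑ i, z i ^ 2 / s i ≤ 1} := by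
    simp [hs_def, Fin.sum_univ_three]
  rw [hset] at hx ⊢
  replace hx : ∑ i, x i ^ 2 / s i ≤ 1 := hx
  have hpot := congrArg ENNReal.toReal
    ((sqrt_pi_mul_lintegral_one_div_norm_sub hs hx).trans (lintegral_exp_mul_chordDensity hs hx))
  rw [ENNReal.toReal_mul, ENNReal.toReal_ofReal (sqrt_nonneg _),
    ← integral_eq_lintegral_of_nonneg_ae (.of_forall fun y ↦ by positivity)
      (Measurable.aestronglyMeasurable (by fun_prop)),
    ← integral_eq_lintegral_of_nonneg_ae ?_ (Measurable.aestronglyMeasurable (by fun_prop))] at hpot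
  swap
  · filter_upwards [ae_restrict_mem measurableSet_Ioi] with t (ht : 0 < t)
    refine mul_nonneg (sub_nonneg.2 (le_trans ?_ hx)) (Finset.prod_nonneg fun i _ ↦ sqrt_nonneg _)
    gcongr with i
    · exact hs i
    · linarith
  have hI0 := integrableOn_one_div_sqrt_prod (pow_pos ha 2) (pow_pos hb 2) (pow_pos hc 2)
  have hI {k : ℝ} (hk : 0 < k) := integrableOn_one_div_add_mul_sqrt_prod (pow_pos ha 2)
    (pow_pos hb 2) (pow_pos hc 2) (pow_pos hk 2)
  have hint : ∫ t in Set.Ioi (0 : ℝ), (1 - ∑ i, x i ^ 2 / (s i + t)) * ∏ i, √(π / (1 + t / s i)) =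
      ∫ t in Set.Ioi (0 : ℝ), √π * (π * a * b * c) *
        (1 / √((a ^ 2 + t) * (b ^ 2 + t) * (c ^ 2 + t)) -
          x 0 ^ 2 * (1 / ((a ^ 2 + t) * √((a ^ 2 + t) * (b ^ 2 + t) * (c ^ 2 + t)))) -
          x 1 ^ 2 * (1 / ((b ^ 2 + t) * √((a ^ 2 + t) * (b ^ 2 + t) * (c ^ 2 + t)))) -
          x 2 ^ 2 * (1 / ((c ^ 2 + t) * √((a ^ 2 + t) * (b ^ 2 + t) * (c ^ 2 + t))))) := by
    refine setIntegral_congr_fun measurableSet_Ioi fun t (ht : 0 < t) ↦ ?_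
    have hroot {k : ℝ} (hk : 0 < k) : √(π / (1 + t / k ^ 2)) = √π * k / √(k ^ 2 + t) := by
      rw [show π / (1 + t / k ^ 2) = π * k ^ 2 / (k ^ 2 + t) by field_simp,
        sqrt_div (by positivity), sqrt_mul pi_pos.le, sqrt_sq hk.le]
    have hpi : √π ^ 2 = π := sq_sqrt pi_pos.le
    simp only [hs_def, Fin.sum_univ_three, Fin.prod_univ_three, Matrix.cons_val, hroot, ha, hb, hc]
    rw [sqrt_mul (by positivity), sqrt_mul (by positivity)]
    nth_rw 5 [← hpi]
    field_simp
    ring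
  rw [hint, integral_const_mul, integral_sub
      (Integrable.sub' (Integrable.sub' hI0 ((hI ha).const_mul _)) ((hI hb).const_mul _))
      ((hI hc).const_mul _),
    integral_sub (Integrable.sub' hI0 ((hI ha).const_mul _)) ((hI hb).const_mul _),
    integral_sub hI0 ((hI ha).const_mul _), integral_const_mul, integral_const_mul,
    integral_const_mul, mul_assoc] at hpot
  rw [mul_left_cancel₀ (sqrt_pos.2 pi_pos).ne' hpot, ellipL0, ellipL1, ellipL2, ellipL3]
  ring
end

section
/- Let a, c > 0 and let D = {x ∈ ℝ³ : (x₁²+x₂²)/a² + x₃²/c² ≤ 1} be the axisymmetric solid ellipsoid with semi-axes a, a, c. Suppose ω₀ ≥ 0 satisfies ω₀²/2 = L₁(a,a,c) − (c²/a²)L₃(a,a,c), where L₁(a,b,c) = πabc ∫₀^∞ ds/((a²+s)√((a²+s)(b²+s)(c²+s))) and L₃(a,b,c) = πabc ∫₀^∞ ds/((c²+s)√((a²+s)(b²+s)(c²+s))). Then the function x ↦ ω₀²(x₁²+x₂²)/2 + ∫_D |x−y|⁻¹ dy is constant on the boundary ∂D; that is, D is a Maclaurin ellipsoid solving the free-boundary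 condition for a uniformly rotating incompressible self-gravitating fluid. -/
open MeasureTheory Real

theorem lintegral_euclideanSpace_three (F : EuclideanSpace ℝ (Fin 3) → ENNReal) :
    ∫⁻ y, F y = ∫⁻ q : ℝ × (ℝ × ℝ), F !₂[q.2.1, q.2.2, q.1] := by
  have h1 := EuclideanSpace.volume_preserving_symm_measurableEquiv_toLp (Fin 3)
  have h2 := volume_preserving_piFinSuccAbove (fun _ : Fin 3 => ℝ) 2
  have h3 := (MeasurePreserving.id (volume : Measure ℝ)).prod (volume_preserving_finTwoArrow ℝ)
  have h4 := h3.comp (h2.comp h1)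
  have hemb := ((MeasurableEquiv.prodCongr (MeasurableEquiv.refl ℝ)
    (MeasurableEquiv.finTwoArrow (α := ℝ))).measurableEmbedding).comp
    ((MeasurableEquiv.piFinSuccAbove (fun _ : Fin 3 => ℝ) 2).measurableEmbedding.comp
      (MeasurableEquiv.toLp 2 (Fin 3 → ℝ)).symm.measurableEmbedding)
  have h5 := h4.lintegral_comp_emb hemb (fun q : ℝ × (ℝ × ℝ) => F !₂[q.2.1, q.2.2, q.1])
  refine Eq.trans (lintegral_congr fun y => ?_) h5
  congr 1
  ext i
  fin_cases i <;> rfl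

theorem lintegral_eq_lintegral_add_smul {t : ℝ} (ht : t ≠ 0) (p₀ : ℝ × ℝ) {g : ℝ × ℝ → ENNReal}
    (hg : Measurable g) :
    ∫⁻ p, g p = ∫⁻ p, ENNReal.ofReal (t ^ 2) * g (p₀ + t • p) := by
  have hm : Measurable fun p : ℝ × ℝ => g (p₀ + p) := by fun_prop
  rw [lintegral_const_mul _ (by fun_prop), ← lintegral_add_left_eq_self g p₀]
  have h := Measure.map_addHaar_smul (volume : Measure (ℝ × ℝ)) ht
  have h2 : ∫⁻ p, g (p₀ + t • p) = ∫⁻ p, g (p₀ + p) ∂(Measure.map (t • ·) volume) := by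
    rw [lintegral_map hm (by fun_prop)]
  have h3 : Module.finrank ℝ (ℝ × ℝ) = 2 := by simp
  rw [h2, h, lintegral_smul_measure, h3, smul_eq_mul, ← mul_assoc,
    ← ENNReal.ofReal_mul (by positivity), abs_of_pos (by positivity),
    mul_inv_cancel₀ (by positivity), ENNReal.ofReal_one, one_mul]

/-- Integration over `ℝ³` in the coordinates `(v, t) ↦ x + t (v₁, v₂, 1)`. -/
theorem lintegral_eq_lintegral_cone (x : EuclideanSpace ℝ (Fin 3))
    {F : EuclideanSpace ℝ (Fin 3) → ENNReal} (hF : Measurable F) :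
    ∫⁻ y, F y = ∫⁻ v : ℝ × ℝ, ∫⁻ t : ℝ, ENNReal.ofReal (t ^ 2) * F (x + t • !₂[v.1, v.2, 1]) := by
  have hG : Measurable fun q : ℝ × (ℝ × ℝ) => F !₂[q.2.1, q.2.2, q.1] := by
    apply hF.comp
    apply Continuous.measurable
    refine (PiLp.continuous_toLp 2 _).comp (continuous_pi fun i => ?_)
    fin_cases i <;> simp <;> fun_prop
  have hcone : Measurable fun q : (ℝ × ℝ) × ℝ =>
      ENNReal.ofReal (q.2 ^ 2) * F (x + q.2 • !₂[q.1.1, q.1.2, 1]) := by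
    refine Measurable.mul (by fun_prop) (hF.comp ?_)
    apply Continuous.measurable
    refine continuous_const.add (continuous_snd.smul ?_)
    refine (PiLp.continuous_toLp 2 _).comp (continuous_pi fun i => ?_)
    fin_cases i <;> simp <;> fun_prop
  rw [lintegral_euclideanSpace_three, Measure.volume_eq_prod, lintegral_prod _ hG.aemeasurable,
    lintegral_lintegral_swap (f := fun (v : ℝ × ℝ) (t : ℝ) =>
      ENNReal.ofReal (t ^ 2) * F (x + t • !₂[v.1, v.2, 1])) hcone.aemeasurable, ← lintegral_add_left_eq_self _ (x 2)]
  refine lintegral_congr_ae ?_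
  filter_upwards [compl_mem_ae_iff.2 (measure_singleton (μ := volume) (0:ℝ))] with t ht
  rw [lintegral_eq_lintegral_add_smul ht (x 0, x 1) (by fun_prop)]
  refine lintegral_congr fun v => ?_
  congr 2
  ext i
  fin_cases i <;> simp

theorem lintegral_uIcc_abs (T : ℝ) :
    ∫⁻ t in Set.uIcc 0 T, ENNReal.ofReal |t| = ENNReal.ofReal (T ^ 2 / 2) := by
  rw [← ofReal_integral_eq_lintegral_ofReal
    (continuous_abs.continuousOn.integrableOn_compact isCompact_uIcc)
    (Filter.Eventually.of_forall fun t => abs_nonneg t)]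
  congr 1
  rcases le_total 0 T with h | h
  · rw [Set.uIcc_of_le h, integral_Icc_eq_integral_Ioc, ← intervalIntegral.integral_of_le h,
      intervalIntegral.integral_congr (g := fun t => t)]
    · exact integral_id.trans (by ring)
    · intro t ht
      rw [Set.uIcc_of_le h] at ht
      exact abs_of_nonneg ht.1
  · rw [Set.uIcc_of_ge h, integral_Icc_eq_integral_Ioc, ← intervalIntegral.integral_of_le h,
      intervalIntegral.integral_congr (g := fun t => -t)]
    · rw [intervalIntegral.integral_neg, integral_id]
      ring
    · intro t ht
      rw [Set.uIcc_of_le h] at ht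
      exact abs_of_nonpos ht.2

theorem mem_uIcc_zero_iff_mul_le {A B t : ℝ} (hA : 0 < A) :
    t ∈ Set.uIcc 0 (-2 * B / A) ↔ 2 * t * B + t ^ 2 * A ≤ 0 := by
  have e : -2 * B / A * A = -2 * B := by field_simp
  set T := -2 * B / A
  have : 2 * t * B + t ^ 2 * A = A * (t * (t - T)) := by linear_combination t * e
  rw [this, Set.mem_uIcc]
  constructor
  · rintro (⟨h1, h2⟩ | ⟨h1, h2⟩)
    · exact mul_nonpos_of_nonneg_of_nonpos hA.le
        (mul_nonpos_of_nonneg_of_nonpos h1 (by linarith))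
    · exact mul_nonpos_of_nonneg_of_nonpos hA.le
        (mul_nonpos_of_nonpos_of_nonneg h2 (by linarith))
  · intro h
    have h' : t * (t - T) ≤ 0 := by
      by_contra hc
      exact absurd h (not_le.2 (mul_pos hA (not_le.1 hc)))
    rcases mul_nonpos_iff.1 h' with ⟨h1, h2⟩ | ⟨h1, h2⟩
    · left; constructor <;> linarith
    · right; constructor <;> linarith

/-- The integral of the Newtonian kernel along the chord through a boundary point `x` of the
ellipsoid in the direction `(v₁, v₂, 1)`. -/
theorem lintegral_ray_of_boundary {a c : ℝ} (ha : 0 < a) (hc : 0 < c)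
    {D : Set (EuclideanSpace ℝ (Fin 3))}
    (hD : D = {x : EuclideanSpace ℝ (Fin 3) |
      ((x 0)^2 + (x 1)^2) / a^2 + (x 2)^2 / c^2 ≤ 1})
    {x : EuclideanSpace ℝ (Fin 3)} (hx : ((x 0)^2 + (x 1)^2) / a^2 + (x 2)^2 / c^2 = 1)
    (v : ℝ × ℝ) :
    ∫⁻ t : ℝ, ENNReal.ofReal (t ^ 2) *
        D.indicator (fun y => ENNReal.ofReal (1 / ‖x - y‖)) (x + t • !₂[v.1, v.2, 1]) =
      ENNReal.ofReal (2 * ((x 0 * v.1 + x 1 * v.2) / a ^ 2 + x 2 / c ^ 2) ^ 2 /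
        (((v.1 ^ 2 + v.2 ^ 2) / a ^ 2 + 1 / c ^ 2) ^ 2 * √(1 + (v.1 ^ 2 + v.2 ^ 2)))) := by
  set A := (v.1 ^ 2 + v.2 ^ 2) / a ^ 2 + 1 / c ^ 2 with hAdef
  set B := (x 0 * v.1 + x 1 * v.2) / a ^ 2 + x 2 / c ^ 2 with hBdef
  set N := √(1 + (v.1 ^ 2 + v.2 ^ 2)) with hN
  have hA : 0 < A := by positivity
  have hNpos : 0 < N := by positivity
  have hw : ‖(!₂[v.1, v.2, 1] : EuclideanSpace ℝ (Fin 3))‖ = N := by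
    rw [EuclideanSpace.norm_eq, hN, Fin.sum_univ_three]
    congr 1
    simp
    ring
  have hmem : ∀ t : ℝ, x + t • !₂[v.1, v.2, 1] ∈ D ↔ t ∈ Set.uIcc 0 (-2 * B / A) := by
    intro t
    rw [mem_uIcc_zero_iff_mul_le hA, hD]
    simp only [Set.mem_ofPred_eq]
    have : (((x + t • !₂[v.1, v.2, 1] : EuclideanSpace ℝ (Fin 3)) 0)^2 +
        ((x + t • !₂[v.1, v.2, 1] : EuclideanSpace ℝ (Fin 3)) 1)^2) / a^2 +
        ((x + t • !₂[v.1, v.2, 1] : EuclideanSpace ℝ (Fin 3)) 2)^2 / c^2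
        = 1 + (2 * t * B + t ^ 2 * A) := by
      rw [hAdef, hBdef]
      simp
      linear_combination hx
    rw [this]
    constructor <;> intro h <;> linarith
  have hint : ∀ t : ℝ, ENNReal.ofReal (t ^ 2) *
        D.indicator (fun y => ENNReal.ofReal (1 / ‖x - y‖)) (x + t • !₂[v.1, v.2, 1]) =
      (Set.uIcc 0 (-2 * B / A)).indicator
        (fun t => ENNReal.ofReal (1 / N) * ENNReal.ofReal |t|) t := by
    intro t
    by_cases ht : t ∈ Set.uIcc 0 (-2 * B / A)
    · rw [Set.indicator_of_mem ht, Set.indicator_of_mem ((hmem t).2 ht),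
        ← ENNReal.ofReal_mul (by positivity), ← ENNReal.ofReal_mul (by positivity)]
      congr 1
      rw [sub_add_cancel_left, norm_neg, norm_smul, hw, Real.norm_eq_abs, ← sq_abs]
      rcases eq_or_ne t 0 with rfl | h0
      · simp
      · have : |t| ≠ 0 := abs_ne_zero.2 h0
        field_simp
    · rw [Set.indicator_of_notMem ht, Set.indicator_of_notMem (mt (hmem t).1 ht), mul_zero]
  rw [lintegral_congr hint, lintegral_indicator measurableSet_uIcc,
    lintegral_const_mul _ (by fun_prop), lintegral_uIcc_abs, ← ENNReal.ofReal_mul (by positivity)]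
  congr 1
  field_simp

theorem integral_inv_norm_sub_of_boundary {a c : ℝ} (ha : 0 < a) (hc : 0 < c)
    {D : Set (EuclideanSpace ℝ (Fin 3))}
    (hD : D = {x : EuclideanSpace ℝ (Fin 3) |
      ((x 0)^2 + (x 1)^2) / a^2 + (x 2)^2 / c^2 ≤ 1})
    {x : EuclideanSpace ℝ (Fin 3)} (hx : ((x 0)^2 + (x 1)^2) / a^2 + (x 2)^2 / c^2 = 1) :
    ∫ y in D, 1 / ‖x - y‖ = ∫ v : ℝ × ℝ,
      2 * ((x 0 * v.1 + x 1 * v.2) / a ^ 2 + x 2 / c ^ 2) ^ 2 /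
        (((v.1 ^ 2 + v.2 ^ 2) / a ^ 2 + 1 / c ^ 2) ^ 2 * √(1 + (v.1 ^ 2 + v.2 ^ 2))) := by
  have hDm : MeasurableSet D := by
    rw [hD]
    apply IsClosed.measurableSet
    exact isClosed_le (by fun_prop) continuous_const
  have hm : Measurable fun y : EuclideanSpace ℝ (Fin 3) => 1 / ‖x - y‖ := by fun_prop
  rw [integral_eq_lintegral_of_nonneg_ae (Filter.Eventually.of_forall fun y => by positivity)
      hm.aestronglyMeasurable,
    integral_eq_lintegral_of_nonneg_ae (Filter.Eventually.of_forall fun y => by positivity)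
      (Measurable.aestronglyMeasurable (by fun_prop)),
    ← lintegral_indicator hDm,
    lintegral_eq_lintegral_cone x (hm.ennreal_ofReal.indicator hDm)]
  simp_rw [lintegral_ray_of_boundary ha hc hD hx]

theorem integral_Ioi_eq_integral_mul_sq {c : ℝ} (hc : 0 < c) (h : ℝ → ℝ) :
    ∫ s in Set.Ioi (0:ℝ), h s = ∫ ρ in Set.Ioi (0:ℝ), 2 * c ^ 2 * ρ * h (c ^ 2 * ρ ^ 2) := by
  have h1 := integral_comp_mul_left_Ioi h 0 (b := c ^ 2) (by positivity)
  have h2 := integral_comp_rpow_Ioi_of_pos (g := fun y => h (c ^ 2 * y)) (p := 2) two_pos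
  rw [mul_zero, smul_eq_mul] at h1
  have h3 : ∫ s in Set.Ioi (0:ℝ), h s = c ^ 2 * ∫ y in Set.Ioi (0:ℝ), h (c ^ 2 * y) := by
    rw [h1]
    field_simp
  rw [h3, ← h2, ← integral_const_mul]
  refine setIntegral_congr_fun measurableSet_Ioi fun ρ _ => ?_
  simp only [smul_eq_mul, rpow_two]
  norm_num
  ring

theorem sqrt_mul_mul_of_sq_subst {a c ρ : ℝ} (hc : 0 < c) :
    √((a ^ 2 + c ^ 2 * ρ ^ 2) * (a ^ 2 + c ^ 2 * ρ ^ 2) * (c ^ 2 + c ^ 2 * ρ ^ 2)) =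
      (a ^ 2 + c ^ 2 * ρ ^ 2) * (c * √(1 + ρ ^ 2)) := by
  have hs : √(1 + ρ ^ 2) ^ 2 = 1 + ρ ^ 2 := sq_sqrt (by positivity)
  rw [← sqrt_sq (by positivity : 0 ≤ (a ^ 2 + c ^ 2 * ρ ^ 2) * (c * √(1 + ρ ^ 2)))]
  congr 1
  rw [mul_pow, mul_pow, hs]
  ring

theorem integral_ellipL1_eq {a c : ℝ} (ha : 0 < a) (hc : 0 < c) :
    ∫ s in Set.Ioi (0:ℝ), 1 / ((a^2+s) * √((a^2+s)*(a^2+s)*(c^2+s))) =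
      2 * c * ∫ ρ in Set.Ioi (0:ℝ), ρ / ((a ^ 2 + c ^ 2 * ρ ^ 2) ^ 2 * √(1 + ρ ^ 2)) := by
  rw [integral_Ioi_eq_integral_mul_sq hc, ← integral_const_mul]
  refine setIntegral_congr_fun measurableSet_Ioi fun ρ _ => ?_
  simp only [sqrt_mul_mul_of_sq_subst hc]
  have : 0 < √(1 + ρ ^ 2) := by positivity
  field_simp

theorem integral_ellipL3_eq {a c : ℝ} (ha : 0 < a) (hc : 0 < c) :
    ∫ s in Set.Ioi (0:ℝ), 1 / ((c^2+s) * √((a^2+s)*(a^2+s)*(c^2+s))) =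
      2 / c * ∫ ρ in Set.Ioi (0:ℝ), ρ / ((1 + ρ ^ 2) * √(1 + ρ ^ 2) * (a ^ 2 + c ^ 2 * ρ ^ 2)) := by
  rw [integral_Ioi_eq_integral_mul_sq hc, ← integral_const_mul]
  refine setIntegral_congr_fun measurableSet_Ioi fun ρ _ => ?_
  simp only [sqrt_mul_mul_of_sq_subst hc]
  have : 0 < √(1 + ρ ^ 2) := by positivity
  field_simp

theorem integrableOn_Ioi_of_le_inv_one_add_sq {f : ℝ → ℝ} (hf : Measurable f) {C : ℝ}
    (hC : ∀ ρ, 0 < ρ → |f ρ| ≤ C * (1 + ρ ^ 2)⁻¹) : IntegrableOn f (Set.Ioi 0) := by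
  refine Integrable.mono' ((integrable_inv_one_add_sq.const_mul C).integrableOn)
    hf.aestronglyMeasurable ?_
  filter_upwards [ae_restrict_mem measurableSet_Ioi] with ρ hρ
  exact hC ρ hρ

theorem integrableOn_pow_div {a c : ℝ} (ha : 0 < a) (hc : 0 < c) {k : ℕ} (hk : k ≤ 3) :
    IntegrableOn (fun ρ : ℝ => ρ ^ k / ((a ^ 2 + c ^ 2 * ρ ^ 2) ^ 2 * √(1 + ρ ^ 2)))
      (Set.Ioi 0) := by
  obtain ⟨m, hm, hma, hmc⟩ : ∃ m : ℝ, 0 < m ∧ m ≤ a ^ 2 ∧ m ≤ c ^ 2 :=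
    ⟨min (a ^ 2) (c ^ 2), lt_min (by positivity) (by positivity), min_le_left _ _,
      min_le_right _ _⟩
  refine integrableOn_Ioi_of_le_inv_one_add_sq (C := (m ^ 2)⁻¹) (by fun_prop) fun ρ hρ => ?_
  have hs : √(1 + ρ ^ 2) ^ 2 = 1 + ρ ^ 2 := sq_sqrt (by positivity)
  rw [abs_of_nonneg (by positivity)]
  set s := √(1 + ρ ^ 2)
  have hspos : 0 < s := by positivity
  have h1 : 1 ≤ s := by nlinarith [sq_nonneg ρ]
  have hρs : ρ ≤ s := abs_le_of_sq_le_sq' (by linarith) hspos.le |>.2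
  have hE : m * s ^ 2 ≤ a ^ 2 + c ^ 2 * ρ ^ 2 := by
    rw [hs]; nlinarith [mul_le_mul_of_nonneg_right hmc (sq_nonneg ρ)]
  rw [← hs]
  calc ρ ^ k / ((a ^ 2 + c ^ 2 * ρ ^ 2) ^ 2 * s) ≤ s ^ 3 / ((m * s ^ 2) ^ 2 * s) := by
        gcongr
        exact (pow_le_pow_left₀ hρ.le hρs k).trans (pow_le_pow_right₀ h1 hk)
    _ = (m ^ 2)⁻¹ * (s ^ 2)⁻¹ := by field_simp

theorem integrableOn_div_one_add_sq_mul_sqrt {a c : ℝ} (ha : 0 < a) :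
    IntegrableOn (fun ρ : ℝ => ρ / ((1 + ρ ^ 2) * √(1 + ρ ^ 2) * (a ^ 2 + c ^ 2 * ρ ^ 2)))
      (Set.Ioi 0) := by
  refine integrableOn_Ioi_of_le_inv_one_add_sq (C := (a ^ 2)⁻¹) (by fun_prop) fun ρ hρ => ?_
  have hs : √(1 + ρ ^ 2) ^ 2 = 1 + ρ ^ 2 := sq_sqrt (by positivity)
  rw [abs_of_nonneg (by positivity)]
  set s := √(1 + ρ ^ 2)
  have hspos : 0 < s := by positivity
  have hρs : ρ ≤ s := abs_le_of_sq_le_sq' (by linarith) hspos.le |>.2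
  calc ρ / ((1 + ρ ^ 2) * s * (a ^ 2 + c ^ 2 * ρ ^ 2)) ≤ s / ((1 + ρ ^ 2) * s * a ^ 2) := by
        gcongr
        nlinarith [sq_nonneg (c * ρ)]
    _ = (a ^ 2)⁻¹ * (1 + ρ ^ 2)⁻¹ := by field_simp

/-- The integrand is an exact derivative vanishing at both ends. -/
theorem integral_Ioi_maclaurin_relation {a c : ℝ} (ha : 0 < a) (hc : 0 < c) :
    c ^ 2 * (∫ ρ in Set.Ioi (0:ℝ), ρ ^ 3 / ((a ^ 2 + c ^ 2 * ρ ^ 2) ^ 2 * √(1 + ρ ^ 2))) -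
      a ^ 2 * (∫ ρ in Set.Ioi (0:ℝ), ρ / ((a ^ 2 + c ^ 2 * ρ ^ 2) ^ 2 * √(1 + ρ ^ 2))) -
      ∫ ρ in Set.Ioi (0:ℝ), ρ / ((1 + ρ ^ 2) * √(1 + ρ ^ 2) * (a ^ 2 + c ^ 2 * ρ ^ 2)) = 0 := by
  have i1 := (integrableOn_pow_div ha hc (k := 3) le_rfl).const_mul (c ^ 2)
  have i2 := (integrableOn_pow_div ha hc (k := 1) (by norm_num)).const_mul (a ^ 2)
  simp only [pow_one] at i2
  have i3 := integrableOn_div_one_add_sq_mul_sqrt (c := c) ha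
  have i12 := integral_sub (i1.sub i2) i3
  simp only [Pi.sub_apply] at i12
  rw [← integral_const_mul, ← integral_const_mul, ← integral_sub i1 i2, ← i12]
  have hderiv : ∀ ρ ∈ Set.Ici (0:ℝ),
      HasDerivAt (fun ρ : ℝ => -(ρ ^ 2 / (√(1 + ρ ^ 2) * (a ^ 2 + c ^ 2 * ρ ^ 2))))
      (c ^ 2 * (ρ ^ 3 / ((a ^ 2 + c ^ 2 * ρ ^ 2) ^ 2 * √(1 + ρ ^ 2))) -
        a ^ 2 * (ρ / ((a ^ 2 + c ^ 2 * ρ ^ 2) ^ 2 * √(1 + ρ ^ 2))) -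
        ρ / ((1 + ρ ^ 2) * √(1 + ρ ^ 2) * (a ^ 2 + c ^ 2 * ρ ^ 2))) ρ := by
    intro ρ _
    have hpos : 0 < 1 + ρ ^ 2 := by positivity
    have hs : √(1 + ρ ^ 2) ^ 2 = 1 + ρ ^ 2 := sq_sqrt (by positivity)
    have hspos : 0 < √(1 + ρ ^ 2) := by positivity
    have hE : 0 < a ^ 2 + c ^ 2 * ρ ^ 2 := by positivity
    have dsq : HasDerivAt (fun ρ : ℝ => ρ ^ 2) (2 * ρ) ρ := by
      simpa using hasDerivAt_pow 2 ρ
    have ds := (dsq.const_add 1).sqrt hpos.ne'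
    have dE := (dsq.const_mul (c ^ 2)).const_add (a ^ 2)
    have := (dsq.div (ds.mul dE) (mul_pos hspos hE).ne').neg
    refine this.congr_deriv ?_
    rw [Pi.mul_apply]
    rw [show (1 + ρ ^ 2) * √(1 + ρ ^ 2) = √(1 + ρ ^ 2) ^ 3 by
      rw [pow_succ (√(1 + ρ ^ 2)) 2, hs]]
    set s := √(1 + ρ ^ 2)
    field_simp
    linear_combination (-ρ * (a ^ 2 + c ^ 2 * ρ ^ 2)) * hs
  have hlim : Filter.Tendsto
      (fun ρ : ℝ => -(ρ ^ 2 / (√(1 + ρ ^ 2) * (a ^ 2 + c ^ 2 * ρ ^ 2))))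
      Filter.atTop (nhds 0) := by
    have h0 : Filter.Tendsto (fun ρ : ℝ => -((c ^ 2)⁻¹ * ρ⁻¹)) Filter.atTop (nhds 0) := by
      simpa using (tendsto_inv_atTop_zero.const_mul ((c ^ 2)⁻¹)).neg
    refine tendsto_of_tendsto_of_tendsto_of_le_of_le' h0 tendsto_const_nhds ?_ ?_
    · filter_upwards [Filter.eventually_gt_atTop 0] with ρ hρ
      rw [neg_le_neg_iff]
      have : ρ ≤ √(1 + ρ ^ 2) := le_sqrt_of_sq_le (by linarith)
      calc ρ ^ 2 / (√(1 + ρ ^ 2) * (a ^ 2 + c ^ 2 * ρ ^ 2)) ≤ ρ ^ 2 / (ρ * (c ^ 2 * ρ ^ 2)) := by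
            gcongr
            nlinarith [sq_nonneg a]
        _ = (c ^ 2)⁻¹ * ρ⁻¹ := by field_simp
    · filter_upwards with ρ
      rw [neg_nonpos]
      positivity
  have := integral_Ioi_of_hasDerivAt_of_tendsto' hderiv ((i1.sub i2).sub i3) hlim
  simpa using this

theorem integral_Ioo_sq_cos_sin (α β : ℝ) :
    ∫ θ in Set.Ioo (-π) π, (α * cos θ + β * sin θ) ^ 2 = π * (α ^ 2 + β ^ 2) := by
  rw [← integral_Ioc_eq_integral_Ioo, ← intervalIntegral.integral_of_le (by linarith [pi_pos])]
  have : ∀ θ : ℝ, (α * cos θ + β * sin θ) ^ 2 =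
    α ^ 2 * cos θ ^ 2 + β ^ 2 * sin θ ^ 2 + 2 * α * β * (sin θ * cos θ) := fun θ => by ring
  simp_rw [this]
  rw [intervalIntegral.integral_add (Continuous.intervalIntegrable (by fun_prop) _ _)
      (Continuous.intervalIntegrable (by fun_prop) _ _),
    intervalIntegral.integral_add (Continuous.intervalIntegrable (by fun_prop) _ _)
      (Continuous.intervalIntegrable (by fun_prop) _ _)]
  simp only [intervalIntegral.integral_const_mul, integral_cos_sq, integral_sin_sq,
    integral_sin_mul_cos₁]
  simp
  ring

theorem integral_Ioo_cos_sin (α β : ℝ) :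
    ∫ θ in Set.Ioo (-π) π, (α * cos θ + β * sin θ) = 0 := by
  rw [← integral_Ioc_eq_integral_Ioo, ← intervalIntegral.integral_of_le (by linarith [pi_pos]),
    intervalIntegral.integral_add (Continuous.intervalIntegrable (by fun_prop) _ _)
      (Continuous.intervalIntegrable (by fun_prop) _ _)]
  simp

theorem integral_boundary_directions {a c : ℝ} (ha : 0 < a) (hc : 0 < c) (α β γ : ℝ) :
    (∫ v : ℝ × ℝ,
      2 * ((α * v.1 + β * v.2) / a ^ 2 + γ / c ^ 2) ^ 2 /
        (((v.1 ^ 2 + v.2 ^ 2) / a ^ 2 + 1 / c ^ 2) ^ 2 * √(1 + (v.1 ^ 2 + v.2 ^ 2)))) =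
      2 * π * c ^ 4 * (α ^ 2 + β ^ 2) *
        (∫ ρ in Set.Ioi (0:ℝ), ρ ^ 3 / ((a ^ 2 + c ^ 2 * ρ ^ 2) ^ 2 * √(1 + ρ ^ 2))) +
      4 * π * a ^ 4 * γ ^ 2 *
        ∫ ρ in Set.Ioi (0:ℝ), ρ / ((a ^ 2 + c ^ 2 * ρ ^ 2) ^ 2 * √(1 + ρ ^ 2)) := by
  let f : ℕ → ℝ → ℝ := fun k ρ => ρ ^ k / ((a ^ 2 + c ^ 2 * ρ ^ 2) ^ 2 * √(1 + ρ ^ 2))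
  have hf : ∀ k ≤ 3, Integrable (f k) (volume.restrict (Set.Ioi 0)) :=
    fun k hk => integrableOn_pow_div ha hc hk
  have hint : ∀ {h : ℝ → ℝ}, Continuous h → Integrable h (volume.restrict (Set.Ioo (-π) π)) :=
    fun hh => (hh.continuousOn.integrableOn_compact isCompact_Icc).mono_set Set.Ioo_subset_Icc_self
  have hpt : ∀ p : ℝ × ℝ, p.1 • (fun v : ℝ × ℝ =>
      2 * ((α * v.1 + β * v.2) / a ^ 2 + γ / c ^ 2) ^ 2 /
        (((v.1 ^ 2 + v.2 ^ 2) / a ^ 2 + 1 / c ^ 2) ^ 2 * √(1 + (v.1 ^ 2 + v.2 ^ 2))))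
        (polarCoord.symm p) =
      2 * c ^ 4 * (f 3 p.1 * (α * cos p.2 + β * sin p.2) ^ 2) +
      4 * a ^ 2 * c ^ 2 * γ * (f 2 p.1 * (α * cos p.2 + β * sin p.2)) +
      2 * a ^ 4 * γ ^ 2 * (f 1 p.1 * 1) := by
    rintro ⟨ρ, θ⟩
    have hsq : (ρ * cos θ) ^ 2 + (ρ * sin θ) ^ 2 = ρ ^ 2 := by
      linear_combination ρ ^ 2 * cos_sq_add_sin_sq θ
    have hs : 0 < √(1 + ρ ^ 2) := by positivity
    have hE : 0 < a ^ 2 + c ^ 2 * ρ ^ 2 := by positivity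
    have hA : ρ ^ 2 / a ^ 2 + 1 / c ^ 2 = (a ^ 2 + c ^ 2 * ρ ^ 2) / (a ^ 2 * c ^ 2) := by
      field_simp
      ring
    simp only [polarCoord_symm_apply, hsq, hA, smul_eq_mul, f]
    field_simp
    ring
  rw [← integral_comp_polarCoord_symm, polarCoord_target]
  simp_rw [hpt]
  rw [Measure.volume_eq_prod, ← Measure.prod_restrict]
  have j3 := ((hf 3 le_rfl).mul_prod (hint (h := fun θ => (α * cos θ + β * sin θ) ^ 2)
    (by fun_prop))).const_mul (2 * c ^ 4)
  have j2 := ((hf 2 (by norm_num)).mul_prod (hint (h := fun θ => α * cos θ + β * sin θ)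
    (by fun_prop))).const_mul (4 * a ^ 2 * c ^ 2 * γ)
  have j1 := ((hf 1 (by norm_num)).mul_prod (hint (h := fun _ => 1)
    (by fun_prop))).const_mul (2 * a ^ 4 * γ ^ 2)
  rw [integral_add (j3.fun_add j2) j1, integral_add j3 j2, integral_const_mul, integral_const_mul,
    integral_const_mul, integral_prod_mul (f 3) (fun θ => (α * cos θ + β * sin θ) ^ 2),
    integral_prod_mul (f 2) (fun θ => α * cos θ + β * sin θ),
    integral_prod_mul (f 1) (fun _ => 1), integral_Ioo_sq_cos_sin, integral_Ioo_cos_sin]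
  simp [f, pi_pos.le]
  ring

/-- Maclaurin ellipsoids: if `ω₀²/2 = L₁(a,a,c) − (c²/a²) L₃(a,a,c)`, then the axisymmetric
ellipsoid with semi-axes `a, a, c` rotating uniformly with angular speed `ω₀` satisfies the
free-boundary condition: `ω₀²(x₁²+x₂²)/2 + ∫_D |x−y|⁻¹ dy` is constant on `∂D`. -/
theorem maclaurin_ellipsoid_free_boundary (a c : ℝ) (ha : 0 < a) (hc : 0 < c)
    (D : Set (EuclideanSpace ℝ (Fin 3)))
    (hD : D = {x : EuclideanSpace ℝ (Fin 3) |
      ((x 0)^2 + (x 1)^2) / a^2 + (x 2)^2 / c^2 ≤ 1})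
    (ω₀ : ℝ) (hω₀ : 0 ≤ ω₀)
    (hMac : ω₀^2 / 2 = ellipL1 a a c - (c^2 / a^2) * ellipL3 a a c) :
    ∃ k : ℝ, ∀ x ∈ frontier D,
      ω₀^2 * ((x 0)^2 + (x 1)^2) / 2 + (∫ y in D, 1 / ‖x - y‖) = k := by
  refine ⟨4 * π * a ^ 4 * c ^ 2 *
    ∫ ρ in Set.Ioi (0:ℝ), ρ / ((a ^ 2 + c ^ 2 * ρ ^ 2) ^ 2 * √(1 + ρ ^ 2)), fun x hx => ?_⟩
  have hx1 : ((x 0)^2 + (x 1)^2) / a^2 + (x 2)^2 / c^2 = 1 := by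
    rw [hD] at hx
    exact frontier_le_subset_eq (f := fun x : EuclideanSpace ℝ (Fin 3) =>
      ((x 0)^2 + (x 1)^2) / a^2 + (x 2)^2 / c^2) (by fun_prop) continuous_const hx
  have hγ : (x 2) ^ 2 = c ^ 2 * (1 - ((x 0)^2 + (x 1)^2) / a^2) := by
    rw [← hx1]
    field_simp
    ring
  rw [integral_inv_norm_sub_of_boundary ha hc hD hx1, integral_boundary_directions ha hc, hγ]
  rw [ellipL1, ellipL3, integral_ellipL1_eq ha hc,
    integral_ellipL3_eq ha hc] at hMac
  have hrel := integral_Ioi_maclaurin_relation ha hc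
  rw [mul_div_right_comm, hMac]
  field_simp
  linear_combination (2 * ((x 0)^2 + (x 1)^2)) * hrel
end

section
/- For e > 0 define I(e) = π ∫₀^∞ (1/((1+s)√(1+e²s))) · (1/(1+s) − 1/(1+e²s)) ds. Then I(e) ≥ 0 if and only if e ≥ 1. Consequently, a Maclaurin ellipsoid of unit volume with ellipticity e (i.e., with ω₀²/2 = I(e) ≥ 0) exists if and only if e ≥ 1, i.e., the ellipsoid is oblate. -/
open MeasureTheory Real

/-- `I(e) = π ∫₀^∞ (1/((1+s)√(1+e²s))) (1/(1+s) − 1/(1+e²s)) ds`, the quantity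
`L₁(a,a,c) − (c²/a²)L₃(a,a,c)` for the unit-volume ellipsoid with ellipticity `e`. -/
noncomputable def maclaurinI (e : ℝ) : ℝ :=
  π * ∫ s in Set.Ioi (0:ℝ),
    (1 / ((1+s) * Real.sqrt (1 + e^2 * s))) * (1 / (1+s) - 1 / (1 + e^2 * s))

/-- The integrand of `maclaurinI e`. -/
noncomputable def maclaurinIntegrand (e s : ℝ) : ℝ :=
  (1 / ((1+s) * Real.sqrt (1 + e^2 * s))) * (1 / (1+s) - 1 / (1 + e^2 * s))

lemma maclaurinI_nonneg {e : ℝ} (h : 1 ≤ e) : 0 ≤ maclaurinI e := by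
  refine mul_nonneg pi_pos.le (setIntegral_nonneg measurableSet_Ioi fun s hs => ?_)
  have hs : 0 < s := hs
  have h1 : 1 + s ≤ 1 + e^2 * s := by nlinarith [one_le_pow₀ h (n := 2)]
  have h2 : 1 / (1 + e^2 * s) ≤ 1 / (1 + s) := one_div_le_one_div_of_le (by positivity) h1
  have h3 := sub_nonneg.2 h2
  positivity

lemma maclaurinIntegrand_neg {e s : ℝ} (he : 0 < e) (h : e < 1) (hs : 0 < s) :
    maclaurinIntegrand e s < 0 := by
  have he2 : e^2 < 1 := by nlinarith
  have h1 : 1 + e^2 * s < 1 + s := by nlinarith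
  have h2 : 1 / (1 + s) < 1 / (1 + e^2 * s) := one_div_lt_one_div_of_lt (by positivity) h1
  exact mul_neg_of_pos_of_neg (by positivity) (sub_neg.2 h2)

lemma neg_maclaurinIntegrand_le {e s : ℝ} (he : 0 < e) (h : e < 1) (hs : 0 < s) :
    -maclaurinIntegrand e s ≤ (e^2)⁻¹ * (1 + s^2)⁻¹ := by
  have he2 : e^2 < 1 := by nlinarith
  have hsqrt : 1 ≤ Real.sqrt (1 + e^2 * s) := Real.one_le_sqrt.2 (by nlinarith [sq_nonneg e])
  have h1 : 1 / ((1+s) * Real.sqrt (1 + e^2 * s)) ≤ 1 / (1 + s) :=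
    one_div_le_one_div_of_le (by positivity) (le_mul_of_one_le_right (by positivity) hsqrt)
  have h2 : 1 / (1 + e^2 * s) ≤ 1 / (e^2 * (1 + s)) :=
    one_div_le_one_div_of_le (by positivity) (by nlinarith)
  have h3 : 0 ≤ 1 / (1 + s) := by positivity
  calc -maclaurinIntegrand e s
      = 1 / ((1+s) * Real.sqrt (1 + e^2 * s)) * (1 / (1 + e^2 * s) - 1 / (1+s)) := by
        unfold maclaurinIntegrand; ring
    _ ≤ 1 / ((1+s) * Real.sqrt (1 + e^2 * s)) * (1 / (e^2 * (1 + s))) :=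
        mul_le_mul_of_nonneg_left (by linarith) (by positivity)
    _ ≤ 1 / (1 + s) * (1 / (e^2 * (1 + s))) := mul_le_mul_of_nonneg_right h1 (by positivity)
    _ = (e^2)⁻¹ * ((1 + s)^2)⁻¹ := by field_simp
    _ ≤ (e^2)⁻¹ * (1 + s^2)⁻¹ := by gcongr; nlinarith

lemma integrableOn_maclaurinIntegrand {e : ℝ} (he : 0 < e) (h : e < 1) :
    IntegrableOn (maclaurinIntegrand e) (Set.Ioi 0) := by
  refine Integrable.mono' ((integrable_inv_one_add_sq.const_mul (e^2)⁻¹).integrableOn) ?_ ?_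
  · have : Measurable (maclaurinIntegrand e) := by unfold maclaurinIntegrand; fun_prop
    exact this.aestronglyMeasurable
  · filter_upwards [ae_restrict_mem measurableSet_Ioi] with s hs
    rw [Real.norm_of_nonpos (maclaurinIntegrand_neg he h hs).le]
    exact neg_maclaurinIntegrand_le he h hs

lemma maclaurinI_neg {e : ℝ} (he : 0 < e) (h : e < 1) : maclaurinI e < 0 := by
  have hpos : 0 < ∫ s in Set.Ioi (0:ℝ), -maclaurinIntegrand e s := by
    rw [setIntegral_pos_iff_support_of_nonneg_ae]
    · have : Set.Ioi (0:ℝ) ⊆ Function.support (fun s => -maclaurinIntegrand e s) :=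
        fun s hs => (neg_pos.2 (maclaurinIntegrand_neg he h hs)).ne'
      rw [Set.inter_eq_right.2 this]
      simp
    · filter_upwards [ae_restrict_mem measurableSet_Ioi] with s hs
      exact (neg_pos.2 (maclaurinIntegrand_neg he h hs)).le
    · exact (integrableOn_maclaurinIntegrand he h).neg
  rw [integral_neg] at hpos
  exact mul_neg_of_pos_of_neg pi_pos (neg_pos.1 hpos)

/-- `I(e) ≥ 0` iff `e ≥ 1`: Maclaurin ellipsoids of unit volume (with
`ω₀²/2 = I(e)` for some real angular speed `ω₀ ≥ 0`) exist precisely when the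
ellipsoid is oblate. -/
theorem maclaurin_exists_iff_oblate (e : ℝ) (he : 0 < e) :
    (0 ≤ maclaurinI e ↔ 1 ≤ e) ∧
      ((∃ ω₀ : ℝ, 0 ≤ ω₀ ∧ ω₀^2 / 2 = maclaurinI e) ↔ 1 ≤ e) := by
  have key : 0 ≤ maclaurinI e ↔ 1 ≤ e :=
    ⟨fun h => not_lt.1 fun hlt => (maclaurinI_neg he hlt).not_ge h, maclaurinI_nonneg⟩
  refine ⟨key, fun ⟨ω₀, _, h⟩ => key.1 (h ▸ by positivity), fun h => ?_⟩
  refine ⟨Real.sqrt (2 * maclaurinI e), Real.sqrt_nonneg _, ?_⟩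
  rw [Real.sq_sqrt (mul_nonneg zero_le_two (key.2 h))]
  ring
end

section
/- For e > 0 define I(e) = π ∫₀^∞ (1/((1+s)√(1+e²s))) · (1/(1+s) − 1/(1+e²s)) ds. Then I(e) → 0 as e → ∞. Consequently, along the family of Maclaurin ellipsoids of unit volume, the angular velocity ω₀ = √(2 I(e)) remains bounded (and in fact tends to 0) as the ellipticity e tends to infinity, even though the equatorial semi-axis a = e^{1/3} tends to infinity. -/
open MeasureTheory Real Filter

lemma abs_maclaurinI_integrand_le {e s : ℝ} (he : 1 ≤ e) (hs : 0 < s) :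
    |(1 / ((1+s) * Real.sqrt (1 + e^2 * s))) * (1 / (1+s) - 1 / (1 + e^2 * s))|
      ≤ (1 + s^2)⁻¹ := by
  have hle : 1 + s ≤ 1 + e^2 * s := by nlinarith [one_le_pow₀ (n := 2) he]
  have hsqrt : 1 ≤ Real.sqrt (1 + e^2 * s) := Real.one_le_sqrt.2 (by linarith)
  have hdiff : 0 ≤ 1 / (1+s) - 1 / (1 + e^2 * s) :=
    sub_nonneg.2 (one_div_le_one_div_of_le (by positivity) hle)
  rw [abs_of_nonneg (mul_nonneg (by positivity) hdiff)]
  calc (1 / ((1+s) * Real.sqrt (1 + e^2 * s))) * (1 / (1+s) - 1 / (1 + e^2 * s))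
      ≤ (1 / (1+s)) * (1 / (1+s)) := by
        gcongr
        · exact le_mul_of_one_le_right (by positivity) hsqrt
        · exact sub_le_self _ (by positivity)
    _ = ((1+s) * (1+s))⁻¹ := by field_simp
    _ ≤ (1 + s^2)⁻¹ := by
        gcongr
        nlinarith

lemma tendsto_maclaurinI_integrand {s : ℝ} (hs : 0 < s) :
    Tendsto (fun e : ℝ =>
      (1 / ((1+s) * Real.sqrt (1 + e^2 * s))) * (1 / (1+s) - 1 / (1 + e^2 * s)))
      atTop (nhds 0) := by
  have hlin : Tendsto (fun e : ℝ => 1 + e^2 * s) atTop atTop :=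
    tendsto_atTop_add_const_left _ _ ((tendsto_pow_atTop two_ne_zero).atTop_mul_const hs)
  have hsqrt : Tendsto (fun e : ℝ => 1 / ((1+s) * Real.sqrt (1 + e^2 * s))) atTop (nhds 0) :=
    ((tendsto_sqrt_atTop.comp hlin).const_mul_atTop (by positivity)).const_div_atTop 1
  simpa using hsqrt.mul ((hlin.const_div_atTop 1).const_sub (1 / (1+s)))

lemma tendsto_maclaurinI_atTop : Tendsto maclaurinI atTop (nhds 0) := by
  have h : Tendsto (fun e : ℝ => ∫ s in Set.Ioi (0:ℝ),
      (1 / ((1+s) * Real.sqrt (1 + e^2 * s))) * (1 / (1+s) - 1 / (1 + e^2 * s)))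
      atTop (nhds (∫ _ in Set.Ioi (0:ℝ), (0:ℝ))) := by
    refine tendsto_integral_filter_of_dominated_convergence (fun s => (1 + s^2)⁻¹)
      (.of_forall fun e => ?_) ?_ integrable_inv_one_add_sq.integrableOn ?_
    · exact Measurable.aestronglyMeasurable (by fun_prop)
    · filter_upwards [eventually_ge_atTop 1] with e he
      filter_upwards [ae_restrict_mem measurableSet_Ioi] with s hs
      exact abs_maclaurinI_integrand_le he hs
    · filter_upwards [ae_restrict_mem measurableSet_Ioi] with s hs
      exact tendsto_maclaurinI_integrand hs
  rw [integral_zero] at h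
  rw [← mul_zero π]
  exact h.const_mul π

/-- As the ellipticity `e → ∞`, `I(e) → 0`; consequently the angular speed
`ω₀ = √(2 I(e))` of the Maclaurin ellipsoid of unit volume tends to `0`
(in particular it stays bounded), even though the equatorial semi-axis
`a = e^{1/3}` tends to infinity. -/
theorem maclaurinI_tendsto_zero :
    Tendsto maclaurinI atTop (nhds 0) ∧
      Tendsto (fun e => Real.sqrt (2 * maclaurinI e)) atTop (nhds 0) ∧
      Tendsto (fun e : ℝ => e ^ ((1:ℝ)/3)) atTop atTop := by
  refine ⟨tendsto_maclaurinI_atTop, ?_, tendsto_rpow_atTop (by norm_num)⟩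
  simpa using (tendsto_maclaurinI_atTop.const_mul 2).sqrt
end

section
/- Let γ > 1 and let ρ : ℝ³ → ℝ be a nonnegative, integrable, radially symmetric function that is continuous on ℝ³, smooth on the open ball B = B_R (R > 0) centered at the origin, positive on B, and zero outside B. Then ρ^{γ−1} − (1/|·| * ρ) is constant on B if and only if the function u = ρ^{γ−1} satisfies the Lane–Emden equation Δu + 4π u^{1/(γ−1)} = 0 on B. -/
open MeasureTheory Real

/-- The Newtonian potential `(1/|·| * ρ)(x) = ∫ ρ(y)/|x−y| dy` on `ℝ³`. -/
noncomputable def pot (ρ : EuclideanSpace ℝ (Fin 3) → ℝ) (x : EuclideanSpace ℝ (Fin 3)) : ℝ :=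
  ∫ y, ρ y / ‖x - y‖

/-- The Laplacian on `ℝ³`: sum of the pure second directional derivatives along the
standard orthonormal basis. -/
noncomputable def lap (u : EuclideanSpace ℝ (Fin 3) → ℝ) (x : EuclideanSpace ℝ (Fin 3)) : ℝ :=
  ∑ i : Fin 3, iteratedFDeriv ℝ 2 u x ![EuclideanSpace.single i 1, EuclideanSpace.single i 1]

lemma lintegral_polar (G : ℝ × ℝ → ENNReal) (hG : Measurable G) :
    ∫⁻ p, G p = ∫⁻ s in Set.Ioi (0 : ℝ), ∫⁻ a in Set.Ioo (-π) π,
      ENNReal.ofReal s * G (s * cos a, s * sin a) := by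
  rw [← lintegral_comp_polarCoord_symm, polarCoord_target, Measure.volume_eq_prod,
    ← Measure.prod_restrict, lintegral_prod _ (by
      simp only [polarCoord_symm_apply, smul_eq_mul]; fun_prop)]
  simp only [polarCoord_symm_apply, smul_eq_mul]

lemma lintegral_axial (H : ℝ × ℝ → ENNReal) (hH : Measurable H) :
    ∫⁻ y : EuclideanSpace ℝ (Fin 3), H (y 0, √(y 1 ^ 2 + y 2 ^ 2)) =
      ∫⁻ p, ENNReal.ofReal (2 * π * p.2) * H p := by
  have h1 : ∫⁻ y : EuclideanSpace ℝ (Fin 3), H (y 0, √(y 1 ^ 2 + y 2 ^ 2)) =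
      ∫⁻ v : Fin 3 → ℝ, H (v 0, √(v 1 ^ 2 + v 2 ^ 2)) :=
    (PiLp.volume_preserving_ofLp (Fin 3)).lintegral_comp
      (f := fun v : Fin 3 → ℝ => H (v 0, √(v 1 ^ 2 + v 2 ^ 2))) (by fun_prop)
  have h2 : ∫⁻ v : Fin 3 → ℝ, H (v 0, √(v 1 ^ 2 + v 2 ^ 2)) =
      ∫⁻ q : ℝ × (Fin 2 → ℝ), H (q.1, √(q.2 0 ^ 2 + q.2 1 ^ 2)) :=
    (volume_preserving_piFinSuccAbove (fun _ : Fin 3 => ℝ) 0).lintegral_comp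
      (f := fun q : ℝ × (Fin 2 → ℝ) => H (q.1, √(q.2 0 ^ 2 + q.2 1 ^ 2))) (by fun_prop)
  have h3 (z : ℝ) : ∫⁻ w : Fin 2 → ℝ, H (z, √(w 0 ^ 2 + w 1 ^ 2)) =
      ∫⁻ q : ℝ × ℝ, H (z, √(q.1 ^ 2 + q.2 ^ 2)) :=
    (volume_preserving_finTwoArrow ℝ).lintegral_comp
      (f := fun q : ℝ × ℝ => H (z, √(q.1 ^ 2 + q.2 ^ 2))) (by fun_prop)
  rw [h1, h2, Measure.volume_eq_prod, lintegral_prod _ (by fun_prop), Measure.volume_eq_prod,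
    lintegral_prod _ (by fun_prop)]
  refine lintegral_congr fun z => ?_
  dsimp only
  rw [h3, lintegral_polar _ (by fun_prop), ← setLIntegral_eq_of_support_subset
    (s := Set.Ioi (0 : ℝ)) (f := fun t => ENNReal.ofReal (2 * π * t) * H (z, t))]
  · refine setLIntegral_congr_fun measurableSet_Ioi fun t ht => ?_
    replace ht : 0 < t := ht
    have : ∀ a : ℝ, √((t * cos a) ^ 2 + (t * sin a) ^ 2) = t := fun a => by
      rw [← Real.sqrt_sq ht.le]; congr 1
      rw [Real.sqrt_sq ht.le]; linear_combination t ^ 2 * sin_sq_add_cos_sq a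
    simp only [this, lintegral_const, Measure.restrict_apply_univ, Real.volume_Ioo]
    rw [mul_right_comm, ← ENNReal.ofReal_mul ht.le]
    congr 2; ring
  · intro t ht
    by_contra h
    simp only [Set.mem_Ioi, not_lt] at h
    apply ht
    simp [ENNReal.ofReal_of_nonpos (mul_nonpos_of_nonneg_of_nonpos two_pi_pos.le h)]

lemma integral_sin_div_sqrt {r s : ℝ} (hr : 0 ≤ r) (hs : 0 < s) :
    ∫⁻ a in Set.Ioo 0 π, ENNReal.ofReal (sin a / √(s ^ 2 - 2 * r * s * cos a + r ^ 2)) =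
      ENNReal.ofReal (2 / max r s) := by
  have hpos : ∀ a ∈ Set.Ioo 0 π, 0 ≤ sin a / √(s ^ 2 - 2 * r * s * cos a + r ^ 2) := fun a ha =>
    div_nonneg (sin_nonneg_of_mem_Icc ⟨ha.1.le, ha.2.le⟩) (sqrt_nonneg _)
  have key : ∃ F : ℝ → ℝ, ContinuousOn F (Set.Icc 0 π) ∧ (∀ a ∈ Set.Ioo 0 π,
      HasDerivAt F (sin a / √(s ^ 2 - 2 * r * s * cos a + r ^ 2)) a) ∧
      F π - F 0 = 2 / max r s := by
    rcases hr.eq_or_lt with rfl | hr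
    · refine ⟨fun a => - cos a / s, by fun_prop, fun a _ => ?_, ?_⟩
      · simpa [sqrt_sq hs.le] using (hasDerivAt_cos a).neg.div_const s
      · simp [hs.le]; ring
    · refine ⟨fun a => √(s ^ 2 - 2 * r * s * cos a + r ^ 2) / (r * s), by fun_prop,
        fun a ha => ?_, ?_⟩
      · have h1 : cos a < 1 := by
          have := cos_lt_cos_of_nonneg_of_le_pi le_rfl ha.2.le ha.1
          simpa using this
        have h2 : 0 < s ^ 2 - 2 * r * s * cos a + r ^ 2 := by
          nlinarith [mul_pos (mul_pos hr hs) (sub_pos.2 h1), sq_nonneg (r - s)]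
        have h3 := ((((hasDerivAt_cos a).const_mul (2 * r * s)).const_sub (s ^ 2)).add_const
          (r ^ 2)).sqrt h2.ne'
        convert! h3.div_const (r * s) using 1
        have := sqrt_pos.2 h2
        field_simp
      · simp only [cos_pi, cos_zero]
        rw [show s ^ 2 - 2 * r * s * -1 + r ^ 2 = (r + s) ^ 2 by ring,
          show s ^ 2 - 2 * r * s * 1 + r ^ 2 = (r - s) ^ 2 by ring, sqrt_sq_eq_abs,
          sqrt_sq_eq_abs, abs_of_pos (by positivity)]
        rcases le_total r s with h | h
        · rw [max_eq_right h, abs_of_nonpos (by linarith)]; field_simp; ring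
        · rw [max_eq_left h, abs_of_nonneg (by linarith)]; field_simp; ring
  obtain ⟨F, hF, hF', hF2⟩ := key
  have hi := intervalIntegral.integrableOn_deriv_of_nonneg hF hF' hpos
  have hi' := (intervalIntegrable_iff_integrableOn_Ioc_of_le pi_pos.le).2 hi
  have := intervalIntegral.integral_eq_sub_of_hasDerivAt_of_le pi_pos.le hF hF' hi'
  rw [← hF2, ← this, intervalIntegral.integral_of_le pi_pos.le, integral_Ioc_eq_integral_Ioo,
    ofReal_integral_eq_lintegral_ofReal (hi.mono_set Set.Ioo_subset_Ioc_self)]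
  exact (ae_restrict_iff' measurableSet_Ioo).2 (ae_of_all _ hpos)

lemma lintegral_angular {r s c : ℝ} (hr : 0 ≤ r) (hs : 0 < s) (hc : 0 ≤ c) :
    ∫⁻ a in Set.Ioo (-π) π, ENNReal.ofReal s * (ENNReal.ofReal (2 * π * (s * sin a)) *
      ENNReal.ofReal (c / √((r - s * cos a) ^ 2 + (s * sin a) ^ 2))) =
      ENNReal.ofReal (4 * π * (c * (s ^ 2 / max r s))) := by
  have hsub : Set.Ioo 0 π ⊆ Set.Ioo (-π) π := Set.Ioo_subset_Ioo_left (by linarith [pi_pos])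
  have hsupp : ∫⁻ a in Set.Ioo (-π) π, ENNReal.ofReal s * (ENNReal.ofReal (2 * π * (s * sin a)) *
      ENNReal.ofReal (c / √((r - s * cos a) ^ 2 + (s * sin a) ^ 2))) =
      ∫⁻ a in Set.Ioo 0 π, ENNReal.ofReal s * (ENNReal.ofReal (2 * π * (s * sin a)) *
      ENNReal.ofReal (c / √((r - s * cos a) ^ 2 + (s * sin a) ^ 2))) := by
    rw [← lintegral_indicator measurableSet_Ioo, ← lintegral_indicator measurableSet_Ioo]
    refine lintegral_congr fun a => ?_
    by_cases ha : a ∈ Set.Ioo 0 π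
    · rw [Set.indicator_of_mem ha, Set.indicator_of_mem (hsub ha)]
    rw [Set.indicator_of_notMem ha]
    by_cases ha' : a ∈ Set.Ioo (-π) π
    swap
    · rw [Set.indicator_of_notMem ha']
    rw [Set.indicator_of_mem ha']
    have h0 : a ≤ 0 := by
      by_contra h
      exact ha ⟨not_le.1 h, ha'.2⟩
    have h1 : sin a ≤ 0 := sin_nonpos_of_nonpos_of_neg_pi_le h0 ha'.1.le
    rw [ENNReal.ofReal_of_nonpos (p := 2 * π * (s * sin a)) (mul_nonpos_of_nonneg_of_nonpos
      two_pi_pos.le (mul_nonpos_of_nonneg_of_nonpos hs.le h1))]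
    simp
  have hmax : 0 < max r s := lt_max_of_lt_right hs
  rw [hsupp, show 4 * π * (c * (s ^ 2 / max r s)) = 2 * π * s ^ 2 * c * (2 / max r s) by ring,
    ENNReal.ofReal_mul (by positivity), ← integral_sin_div_sqrt hr hs,
    ← lintegral_const_mul _ (by fun_prop)]
  refine setLIntegral_congr_fun measurableSet_Ioo fun a ha => ?_
  have hsin : 0 ≤ sin a := sin_nonneg_of_mem_Icc ⟨ha.1.le, ha.2.le⟩
  rw [← ENNReal.ofReal_mul (by positivity), ← ENNReal.ofReal_mul (by positivity),
    ← ENNReal.ofReal_mul (by positivity),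
    show (r - s * cos a) ^ 2 + (s * sin a) ^ 2 = s ^ 2 - 2 * r * s * cos a + r ^ 2 by
      linear_combination s ^ 2 * sin_sq_add_cos_sq a]
  congr 1; ring

lemma norm_smul_single (s : ℝ) : ‖s • EuclideanSpace.single (0 : Fin 3) (1 : ℝ)‖ = |s| := by
  simp [norm_smul]

/-- Newton's shell theorem for a continuous radial density. -/
lemma pot_eq_integral_Ioi {ρ : EuclideanSpace ℝ (Fin 3) → ℝ} (hnonneg : ∀ x, 0 ≤ ρ x)
    (hradial : ∀ x y : EuclideanSpace ℝ (Fin 3), ‖x‖ = ‖y‖ → ρ x = ρ y)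
    (hcont : Continuous ρ) {r : ℝ} (hr : 0 ≤ r) :
    pot ρ (r • EuclideanSpace.single 0 1) =
      ∫ s in Set.Ioi 0, 4 * π * (ρ (s • EuclideanSpace.single 0 1) * (s ^ 2 / max r s)) := by
  have hm : Measurable ρ := hcont.measurable
  set f : ℝ → ℝ := fun s => ρ (s • EuclideanSpace.single 0 1) with hf
  have hfm : Measurable f := by rw [hf]; fun_prop
  rw [pot, integral_eq_lintegral_of_nonneg_ae
    (ae_of_all _ fun y => div_nonneg (hnonneg y) (norm_nonneg _))
    (hm.div (by fun_prop)).aestronglyMeasurable,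
    integral_eq_lintegral_of_nonneg_ae _ (by fun_prop)]
  · congr 1
    have h1 (y : EuclideanSpace ℝ (Fin 3)) :
        ENNReal.ofReal (ρ y / ‖r • EuclideanSpace.single 0 1 - y‖) =
        (fun p : ℝ × ℝ => ENNReal.ofReal (f (√(p.1 ^ 2 + p.2 ^ 2)) / √((r - p.1) ^ 2 + p.2 ^ 2)))
          (y 0, √(y 1 ^ 2 + y 2 ^ 2)) := by
      have h2 : √(y 1 ^ 2 + y 2 ^ 2) ^ 2 = y 1 ^ 2 + y 2 ^ 2 := sq_sqrt (by positivity)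
      simp only [h2, hf]
      congr 2
      · refine hradial _ _ ?_
        rw [norm_smul_single, abs_of_nonneg (sqrt_nonneg _), EuclideanSpace.norm_eq]
        simp [Fin.sum_univ_three, add_assoc]
      · rw [EuclideanSpace.norm_eq]
        simp [Fin.sum_univ_three, add_assoc]
    rw [lintegral_congr h1, lintegral_axial (fun p : ℝ × ℝ =>
      ENNReal.ofReal (f (√(p.1 ^ 2 + p.2 ^ 2)) / √((r - p.1) ^ 2 + p.2 ^ 2))) (by fun_prop), lintegral_polar _ (by fun_prop)]
    refine setLIntegral_congr_fun measurableSet_Ioi fun s hs => ?_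
    replace hs : 0 < s := hs
    have : ∀ a : ℝ, √((s * cos a) ^ 2 + (s * sin a) ^ 2) = s := fun a => by
      rw [← Real.sqrt_sq hs.le]; congr 1
      rw [Real.sqrt_sq hs.le]; linear_combination s ^ 2 * sin_sq_add_cos_sq a
    simp only [this]
    exact lintegral_angular hr hs (hnonneg _)
  · refine ae_of_all _ fun s => ?_
    have := hnonneg (s • EuclideanSpace.single 0 1)
    have : 0 ≤ max r s := le_max_of_le_left hr
    dsimp only [hf, Pi.zero_apply]
    positivity

lemma pot_radial {ρ : EuclideanSpace ℝ (Fin 3) → ℝ}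
    (hradial : ∀ x y : EuclideanSpace ℝ (Fin 3), ‖x‖ = ‖y‖ → ρ x = ρ y)
    {x y : EuclideanSpace ℝ (Fin 3)} (h : ‖x‖ = ‖y‖) : pot ρ x = pot ρ y := by
  let e := (Submodule.span ℝ {x - y})ᗮ.reflection
  have he : e x = y := Submodule.reflection_sub h
  have h1 := e.measurePreserving.integral_comp e.toHomeomorph.measurableEmbedding
    (fun z => ρ z / ‖y - z‖)
  rw [pot, pot, ← h1]
  refine integral_congr_ae (ae_of_all _ fun z => ?_)
  dsimp only
  rw [hradial z (e z) (e.norm_map z).symm, ← he, ← map_sub, e.norm_map]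

lemma pot_eq_integral {ρ : EuclideanSpace ℝ (Fin 3) → ℝ} {R : ℝ} (hR : 0 < R)
    (hnonneg : ∀ x, 0 ≤ ρ x)
    (hradial : ∀ x y : EuclideanSpace ℝ (Fin 3), ‖x‖ = ‖y‖ → ρ x = ρ y)
    (hcont : Continuous ρ)
    (hzero : ∀ x ∉ Metric.ball (0 : EuclideanSpace ℝ (Fin 3)) R, ρ x = 0)
    {r : ℝ} (hr : 0 ≤ r) :
    pot ρ (r • EuclideanSpace.single 0 1) =
      4 * π * ∫ s in 0..R, ρ (s • EuclideanSpace.single 0 1) * (s ^ 2 / max r s) := by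
  rw [pot_eq_integral_Ioi hnonneg hradial hcont hr, integral_const_mul,
    intervalIntegral.integral_of_le hR.le]
  congr 1
  refine setIntegral_eq_of_subset_of_forall_sdiff_eq_zero measurableSet_Ioi
    Set.Ioc_subset_Ioi_self fun s hs => ?_
  have h0 : 0 < s := hs.1
  have h1 : R < s := not_le.1 fun h => hs.2 ⟨h0, h⟩
  rw [hzero, zero_mul]
  rw [mem_ball_zero_iff, norm_smul_single, abs_of_pos h0]
  exact not_lt.2 h1.le

lemma hasDerivAt_integral_div_max {f : ℝ → ℝ} (hf : Continuous f) {R r : ℝ}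
    (hr : r ∈ Set.Ioo 0 R) :
    HasDerivAt (fun r => ∫ s in 0..R, f s * (s ^ 2 / max r s))
      (-(∫ s in 0..r, f s * s ^ 2) / r ^ 2) r := by
  have hM : HasDerivAt (fun r => ∫ s in 0..r, f s * s ^ 2) (f r * r ^ 2) r :=
    intervalIntegral.integral_hasDerivAt_right (Continuous.intervalIntegrable (by fun_prop) _ _)
      (Continuous.stronglyMeasurableAtFilter (by fun_prop) _ _)
      (Continuous.continuousAt (by fun_prop))
  have hN : HasDerivAt (fun r => ∫ s in 0..r, f s * s) (f r * r) r :=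
    intervalIntegral.integral_hasDerivAt_right (Continuous.intervalIntegrable (by fun_prop) _ _)
      (Continuous.stronglyMeasurableAtFilter (by fun_prop) _ _)
      (Continuous.continuousAt (by fun_prop))
  have hr0 := hr.1
  have h := (hM.div (hasDerivAt_id r) hr0.ne').add (hN.const_sub (∫ s in 0..R, f s * s))
  refine (h.congr_of_eventuallyEq ?_).congr_deriv ?_
  · filter_upwards [Ioo_mem_nhds hr.1 hr.2] with t ht
    have ht0 := ht.1
    have e1 : Set.EqOn (fun s => f s * (s ^ 2 / max t s)) (fun s => f s * s ^ 2 / t)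
        (Set.uIcc 0 t) := by
      intro s hs
      rw [Set.uIcc_of_le ht.1.le] at hs
      simp only [max_eq_left hs.2]; ring
    have e2 : Set.EqOn (fun s => f s * (s ^ 2 / max t s)) (fun s => f s * s)
        (Set.uIcc t R) := by
      intro s hs
      rw [Set.uIcc_of_le ht.2.le] at hs
      have : 0 < s := ht0.trans_le hs.1
      simp only [max_eq_right hs.1]; field_simp
    have i1 : IntervalIntegrable (fun s => f s * (s ^ 2 / max t s)) volume 0 t :=
      ContinuousOn.intervalIntegrable ((by fun_prop : ContinuousOn _ _).congr e1)
    have i2 : IntervalIntegrable (fun s => f s * (s ^ 2 / max t s)) volume t R :=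
      ContinuousOn.intervalIntegrable ((by fun_prop : ContinuousOn _ _).congr e2)
    rw [← intervalIntegral.integral_add_adjacent_intervals i1 i2,
      intervalIntegral.integral_congr e1, intervalIntegral.integral_congr e2,
      intervalIntegral.integral_div]
    simp only [Pi.add_apply, Pi.div_apply, id]
    rw [intervalIntegral.integral_interval_sub_left
      (Continuous.intervalIntegrable (by fun_prop) _ _)
      (Continuous.intervalIntegrable (by fun_prop) _ _)]
  · simp only [id]; field_simp; ring

lemma continuousOn_integral_div_max {f : ℝ → ℝ} (hf : Continuous f) {R : ℝ} (hR : 0 < R) :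
    ContinuousOn (fun r => ∫ s in 0..R, f s * (s ^ 2 / max r s)) (Set.Ici 0) := by
  intro r hr
  refine intervalIntegral.continuousWithinAt_of_dominated_interval
    (bound := fun s => |f s| * s) ?_ ?_ (Continuous.intervalIntegrable (by fun_prop) _ _) ?_
  · exact Filter.Eventually.of_forall fun t => Measurable.aestronglyMeasurable
      (hf.measurable.mul (by fun_prop))
  · filter_upwards [self_mem_nhdsWithin] with t ht
    refine ae_of_all _ fun s hs => ?_
    rw [Set.uIoc_of_le hR.le] at hs
    have hs0 := hs.1
    have hm : 0 < max t s := lt_max_of_lt_right hs0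
    rw [norm_mul, norm_eq_abs, norm_eq_abs, abs_of_nonneg (a := s ^ 2 / max t s) (by positivity)]
    gcongr
    rw [div_le_iff₀ hm, sq]
    gcongr
    exact le_max_right _ _
  · refine ae_of_all _ fun s hs => ?_
    rw [Set.uIoc_of_le hR.le] at hs
    have : max r s ≠ 0 := (lt_max_of_lt_right hs.1).ne'
    have hc : ContinuousAt (fun q => f s * (s ^ 2 / max q s)) r :=
      continuousAt_const.mul (continuousAt_const.div (by fun_prop) this)
    exact hc.continuousWithinAt

lemma eq_left_of_hasDerivAt_zero {h : ℝ → ℝ} {R : ℝ} (hc : ContinuousOn h (Set.Ico 0 R))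
    (hd : ∀ r ∈ Set.Ioo 0 R, HasDerivAt h 0 r) : ∀ r ∈ Set.Ico 0 R, h r = h 0 := by
  intro r hr
  rcases hr.1.eq_or_lt with rfl | h0
  · rfl
  obtain ⟨c, -, hc⟩ := exists_hasDerivAt_eq_slope h (fun _ => 0) h0
    (hc.mono fun t ht => ⟨ht.1, ht.2.trans_lt hr.2⟩) fun t ht => hd t ⟨ht.1, ht.2.trans hr.2⟩
  have : r - 0 ≠ 0 := by simpa using h0.ne'
  rw [eq_comm, div_eq_zero_iff] at hc
  exact sub_eq_zero.1 (hc.resolve_right this)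

lemma radial_ode_iff {f φ : ℝ → ℝ} (hf : Continuous f) {R : ℝ} (hR : 0 < R)
    (hφ : ContDiffOn ℝ 2 φ (Set.Ioo (-R) R)) :
    (∃ k, ∀ r ∈ Set.Ico 0 R, φ r - 4 * π * ∫ s in 0..R, f s * (s ^ 2 / max r s) = k) ↔
      ∀ r ∈ Set.Ioo 0 R, deriv (deriv φ) r + 2 / r * deriv φ r = -(4 * π * f r) := by
  have hsub : Set.Ioo 0 R ⊆ Set.Ioo (-R) R := Set.Ioo_subset_Ioo_left (by linarith)
  have hsub' : Set.Ico 0 R ⊆ Set.Ioo (-R) R := fun t ht => ⟨by linarith [ht.1], ht.2⟩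
  have hφ1 : ∀ r ∈ Set.Ioo (-R) R, HasDerivAt φ (deriv φ r) r := fun r hr =>
    ((hφ.differentiableOn (by norm_num)).differentiableAt
      (isOpen_Ioo.mem_nhds hr)).hasDerivAt
  have hφ' : ContDiffOn ℝ 1 (deriv φ) (Set.Ioo (-R) R) :=
    ((contDiffOn_succ_iff_deriv_of_isOpen (n := 1) isOpen_Ioo).1 hφ).2.2
  have hφ2 : ∀ r ∈ Set.Ioo (-R) R, HasDerivAt (deriv φ) (deriv (deriv φ) r) r := fun r hr =>
    ((hφ'.differentiableOn (by norm_num)).differentiableAt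
      (isOpen_Ioo.mem_nhds hr)).hasDerivAt
  have hV : ∀ r ∈ Set.Ioo 0 R, HasDerivAt (fun r => 4 * π * ∫ s in 0..R, f s * (s ^ 2 / max r s))
      (4 * π * (-(∫ s in 0..r, f s * s ^ 2) / r ^ 2)) r := fun r hr =>
    (hasDerivAt_integral_div_max hf hr).const_mul _
  have hM (r : ℝ) : HasDerivAt (fun r => ∫ s in 0..r, f s * s ^ 2) (f r * r ^ 2) r :=
    intervalIntegral.integral_hasDerivAt_right (Continuous.intervalIntegrable (by fun_prop) _ _)
      (Continuous.stronglyMeasurableAtFilter (by fun_prop) _ _)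
      (Continuous.continuousAt (by fun_prop))
  constructor
  · rintro ⟨k, hk⟩ r hr
    have hd : ∀ t ∈ Set.Ioo 0 R, deriv φ t = 4 * π * (-(∫ s in 0..t, f s * s ^ 2) / t ^ 2) := by
      intro t ht
      refine HasDerivAt.deriv (((hV t ht).add_const k).congr_of_eventuallyEq ?_)
      filter_upwards [isOpen_Ioo.mem_nhds ht] with q hq
      linarith [hk q ⟨hq.1.le, hq.2⟩]
    have hr0 := hr.1
    have h2 := ((hM r).neg.div ((hasDerivAt_id r).pow 2) (by simpa using hr0.ne')).const_mul (4 * π)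
    have h3 : deriv φ =ᶠ[nhds r] fun t => 4 * π * (-(∫ s in 0..t, f s * s ^ 2) / t ^ 2) := by
      filter_upwards [isOpen_Ioo.mem_nhds hr] with q hq using hd q hq
    rw [h3.deriv_eq, hd r hr]
    erw [h2.deriv]
    simp
    field_simp
    ring
  · intro h
    have hA : ∀ r ∈ Set.Ico 0 R, r ^ 2 * deriv φ r + 4 * π * ∫ s in 0..r, f s * s ^ 2 = 0 := by
      intro r hr
      have := eq_left_of_hasDerivAt_zero (R := R)
        (h := fun r => r ^ 2 * deriv φ r + 4 * π * ∫ s in 0..r, f s * s ^ 2) ?_ ?_ r hr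
      · simpa using this
      · intro t ht
        exact ((((hasDerivAt_id t).pow 2).mul (hφ2 t (hsub' ht))).add
          ((hM t).const_mul (4 * π))).continuousAt.continuousWithinAt
      · intro t ht
        have ht0 := ht.1
        refine ((((hasDerivAt_id t).pow 2).mul (hφ2 t (hsub ht))).add
          ((hM t).const_mul (4 * π))).congr_deriv ?_
        have h5 := h t ht
        field_simp at h5
        simp
        linear_combination t * h5
    refine ⟨_, eq_left_of_hasDerivAt_zero (fun t ht =>
      ((hφ1 t (hsub' ht)).continuousAt.continuousWithinAt).sub
        (((continuousOn_integral_div_max hf hR).mono Set.Ico_subset_Ici_self t ht).const_mul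
          (4 * π))) fun t ht => ?_⟩
    refine ((hφ1 t (hsub ht)).sub (hV t ht)).congr_deriv ?_
    have h5 := hA t ⟨ht.1.le, ht.2⟩
    have ht0 := ht.1
    field_simp
    linear_combination h5

lemma iteratedFDeriv_two_radial {E : Type*} [NormedAddCommGroup E] [InnerProductSpace ℝ E]
    {φ : ℝ → ℝ} {x : E} (hx : x ≠ 0) (hφ : ContDiffAt ℝ 2 φ ‖x‖) (v : E) :
    iteratedFDeriv ℝ 2 (fun y : E => φ ‖y‖) x ![v, v] =
      deriv (deriv φ) ‖x‖ * (inner ℝ x v / ‖x‖) ^ 2 +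
        deriv φ ‖x‖ * ((‖v‖ ^ 2 * ‖x‖ ^ 2 - inner ℝ x v ^ 2) / ‖x‖ ^ 3) := by
  set u : E → ℝ := fun y => φ ‖y‖ with hu
  have hline (y : E) : HasDerivAt (fun t : ℝ => y + t • v) v 0 := by
    simpa using ((hasDerivAt_id (0 : ℝ)).smul_const v).const_add y
  have hnorm : ∀ y : E, y ≠ 0 → HasDerivAt (fun t : ℝ => ‖y + t • v‖) (inner ℝ y v / ‖y‖) 0 := by
    intro y hy
    have hy' : 0 < ‖y‖ := norm_pos_iff.2 hy
    have h := ((hline y).norm_sq).sqrt (by simpa using hy)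
    simp only [zero_smul, add_zero, sqrt_sq (norm_nonneg _)] at h
    refine h.congr_deriv ?_
    field_simp
  have hnx : 0 < ‖x‖ := norm_pos_iff.2 hx
  have huc : ContDiffAt ℝ 2 u x := ContDiffAt.comp x hφ (contDiffAt_norm ℝ hx)
  have hfd : ∀ᶠ y in nhds x, fderiv ℝ u y v = deriv φ ‖y‖ * (inner ℝ y v / ‖y‖) := by
    have hφe : ∀ᶠ y in nhds x, ContDiffAt ℝ 2 φ ‖y‖ :=
      (continuous_norm.tendsto x).eventually (hφ.eventually (by simp))
    filter_upwards [huc.eventually (by simp), hφe, isOpen_ne.mem_nhds hx] with y h1 h2 h3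
    have h4 : HasFDerivAt u (fderiv ℝ u y) (y + (0 : ℝ) • v) := by
      simpa using (h1.differentiableAt (by norm_num)).hasFDerivAt
    have h5 := h4.comp_hasDerivAt 0 (hline y)
    have h6 : HasDerivAt φ (deriv φ ‖y‖) ‖y + (0 : ℝ) • v‖ := by
      simpa using (h2.differentiableAt (by norm_num)).hasDerivAt
    exact h5.unique (h6.comp 0 (hnorm y h3))
  have hlim : Filter.Tendsto (fun t : ℝ => x + t • v) (nhds 0) (nhds x) := by
    simpa using (hline x).continuousAt.tendsto
  have h1 : HasFDerivAt (fderiv ℝ u) (fderiv ℝ (fderiv ℝ u) x) (x + (0 : ℝ) • v) := by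
    have : ContDiffAt ℝ 1 (fderiv ℝ u) x := huc.fderiv_right (by norm_num)
    simpa using (this.differentiableAt (by norm_num)).hasFDerivAt
  have h2 : HasDerivAt (fun t : ℝ => fderiv ℝ u (x + t • v) v)
      (fderiv ℝ (fderiv ℝ u) x v v) 0 := by
    have h : HasDerivAt (fun t : ℝ => fderiv ℝ u (x + t • v)) (fderiv ℝ (fderiv ℝ u) x v) 0 :=
      h1.comp_hasDerivAt 0 (hline x)
    exact (ContinuousLinearMap.apply ℝ ℝ v).hasFDerivAt.comp_hasDerivAt 0 h
  have h3 : HasDerivAt (deriv φ) (deriv (deriv φ) ‖x‖) ‖x + (0 : ℝ) • v‖ := by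
    have : ContDiffAt ℝ 1 (deriv φ) ‖x‖ :=
      (hφ.fderiv_right (m := 1) (by norm_num)).clm_apply contDiffAt_const
    simpa using (this.differentiableAt (by norm_num)).hasDerivAt
  have h4 : HasDerivAt (fun t : ℝ => inner ℝ (x + t • v) v) (‖v‖ ^ 2) 0 := by
    simpa using (hline x).inner ℝ (hasDerivAt_const 0 v)
  have h5 := (h3.comp 0 (hnorm x hx)).mul (h4.div (hnorm x hx) (by simpa using hx))
  rw [iteratedFDeriv_two_apply]
  simp only [Matrix.cons_val_zero, Matrix.cons_val_one]
  refine (h2.congr_of_eventuallyEq ?_).unique (h5.congr_deriv ?_)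
  · filter_upwards [hlim.eventually hfd] with t ht
    simp [ht]
  · simp
    field_simp

lemma lap_radial {φ : ℝ → ℝ} {x : EuclideanSpace ℝ (Fin 3)} (hx : x ≠ 0)
    (hφ : ContDiffAt ℝ 2 φ ‖x‖) :
    lap (fun y => φ ‖y‖) x = deriv (deriv φ) ‖x‖ + 2 / ‖x‖ * deriv φ ‖x‖ := by
  have hnx : 0 < ‖x‖ := norm_pos_iff.2 hx
  have hsq : ‖x‖ ^ 2 = x 0 ^ 2 + x 1 ^ 2 + x 2 ^ 2 := by
    rw [EuclideanSpace.norm_sq_eq]; simp [Fin.sum_univ_three]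
  simp only [lap, iteratedFDeriv_two_radial hx hφ, Fin.sum_univ_three,
    EuclideanSpace.inner_single_right]
  simp
  field_simp
  linear_combination (-‖x‖ * deriv (deriv φ) ‖x‖ + deriv φ ‖x‖) * hsq

lemma continuousAt_lap {u : EuclideanSpace ℝ (Fin 3) → ℝ} {x : EuclideanSpace ℝ (Fin 3)}
    (hu : ContDiffAt ℝ 2 u x) : ContinuousAt (lap u) x := by
  have h : ContDiffAt ℝ 0 (iteratedFDeriv ℝ 2 u) x := hu.iteratedFDeriv_right (by norm_num)
  exact tendsto_finsetSum _ fun i _ => ((ContinuousMultilinearMap.apply ℝ _ _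
    ![EuclideanSpace.single i 1, EuclideanSpace.single i 1]).continuous.continuousAt.comp
      h.continuousAt)

/-- For a nonnegative integrable continuous radial density `ρ`, positive in the ball `B_R`,
smooth there and vanishing outside, the hydrostatic relation
`ρ^{γ−1} − (1/|·| * ρ) = const` on `B_R` is equivalent to the Lane–Emden equation
`Δu + 4π u^{1/(γ−1)} = 0` on `B_R` for `u = ρ^{γ−1}`. -/
theorem lane_emden_equivalence (γ : ℝ) (hγ : 1 < γ) (R : ℝ) (hR : 0 < R)
    (ρ : EuclideanSpace ℝ (Fin 3) → ℝ)
    (hnonneg : ∀ x, 0 ≤ ρ x)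
    (hint : Integrable ρ)
    (hradial : ∀ x y : EuclideanSpace ℝ (Fin 3), ‖x‖ = ‖y‖ → ρ x = ρ y)
    (hcont : Continuous ρ)
    (hsmooth : ContDiffOn ℝ (⊤ : ℕ∞) ρ (Metric.ball (0 : EuclideanSpace ℝ (Fin 3)) R))
    (hpos : ∀ x ∈ Metric.ball (0 : EuclideanSpace ℝ (Fin 3)) R, 0 < ρ x)
    (hzero : ∀ x ∉ Metric.ball (0 : EuclideanSpace ℝ (Fin 3)) R, ρ x = 0) :
    (∃ k : ℝ, ∀ x ∈ Metric.ball (0 : EuclideanSpace ℝ (Fin 3)) R,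
        ρ x ^ (γ - 1) - pot ρ x = k) ↔
      (∀ x ∈ Metric.ball (0 : EuclideanSpace ℝ (Fin 3)) R,
        lap (fun y => ρ y ^ (γ - 1)) x
          + 4 * π * ((fun y => ρ y ^ (γ - 1)) x) ^ (1 / (γ - 1)) = 0) := by
  set e : EuclideanSpace ℝ (Fin 3) := EuclideanSpace.single 0 1 with he
  set u : EuclideanSpace ℝ (Fin 3) → ℝ := fun y => ρ y ^ (γ - 1) with hu
  set φ : ℝ → ℝ := fun r => u (r • e) with hφ
  have hnorm (r : ℝ) : ‖r • e‖ = |r| := norm_smul_single r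
  have hnorm' (x : EuclideanSpace ℝ (Fin 3)) : ‖x‖ = ‖‖x‖ • e‖ := by
    rw [hnorm, abs_of_nonneg (norm_nonneg x)]
  have huφ : u = fun y => φ ‖y‖ := by
    funext y
    simp only [hφ, hu]
    rw [hradial y _ (hnorm' y)]
  have husmooth : ContDiffOn ℝ 2 u (Metric.ball 0 R) :=
    (hsmooth.of_le (WithTop.coe_le_coe.2 (le_top (a := (2 : ℕ∞))))).rpow_const_of_ne fun x hx => (hpos x hx).ne'
  have hφsmooth : ContDiffOn ℝ 2 φ (Set.Ioo (-R) R) := by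
    refine husmooth.comp (by fun_prop) fun r hr => ?_
    rw [mem_ball_zero_iff, hnorm]
    exact abs_lt.2 hr
  have hpow : ∀ x, u x ^ (1 / (γ - 1)) = ρ x := fun x => by
    simp only [hu]
    rw [one_div, rpow_rpow_inv (hnonneg x) (by linarith)]
  have hf : Continuous fun r : ℝ => ρ (r • e) := by fun_prop
  have hlap : ∀ x ∈ Metric.ball (0 : EuclideanSpace ℝ (Fin 3)) R, x ≠ 0 →
      lap u x = deriv (deriv φ) ‖x‖ + 2 / ‖x‖ * deriv φ ‖x‖ := fun x hx h0 => by
    rw [huφ]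
    refine lap_radial h0 (hφsmooth.contDiffAt (isOpen_Ioo.mem_nhds ⟨?_, ?_⟩))
    · linarith [norm_nonneg x]
    · simpa using hx
  have hleft : (∃ k : ℝ, ∀ x ∈ Metric.ball (0 : EuclideanSpace ℝ (Fin 3)) R,
      u x - pot ρ x = k) ↔ ∃ k, ∀ r ∈ Set.Ico 0 R,
        φ r - 4 * π * ∫ s in 0..R, ρ (s • e) * (s ^ 2 / max r s) = k := by
    refine exists_congr fun k => ⟨fun h r hr => ?_, fun h x hx => ?_⟩
    · rw [← pot_eq_integral hR hnonneg hradial hcont hzero hr.1]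
      refine h _ ?_
      rw [mem_ball_zero_iff, hnorm, abs_of_nonneg hr.1]
      exact hr.2
    · rw [mem_ball_zero_iff] at hx
      rw [pot_radial hradial (hnorm' x),
        pot_eq_integral hR hnonneg hradial hcont hzero (norm_nonneg x), huφ]
      exact h _ ⟨norm_nonneg x, hx⟩
  simp only [hpow]
  refine hleft.trans ((radial_ode_iff hf hR hφsmooth).trans ⟨fun h => ?_, fun h r hr => ?_⟩)
  · have hne : ∀ x ∈ Metric.ball (0 : EuclideanSpace ℝ (Fin 3)) R, x ≠ 0 →
        lap u x + 4 * π * ρ x = 0 := fun x hx h0 => by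
      rw [hlap x hx h0, h _ ⟨norm_pos_iff.2 h0, mem_ball_zero_iff.1 hx⟩, hradial x _ (hnorm' x)]
      ring
    intro x hx
    rcases ne_or_eq x 0 with h0 | rfl
    · exact hne x hx h0
    have hball := Metric.isOpen_ball.mem_nhds hx
    have hc : ContinuousAt (fun y => lap u y + 4 * π * ρ y) 0 :=
      (continuousAt_lap (husmooth.contDiffAt hball)).add (by fun_prop)
    refine tendsto_nhds_unique (hc.tendsto.mono_left (nhdsWithin_le_nhds (s := {0}ᶜ))) ?_
    refine tendsto_const_nhds.congr' ?_
    filter_upwards [nhdsWithin_le_nhds hball, self_mem_nhdsWithin] with y hy hy0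
    exact (hne y hy hy0).symm
  · have hb : r • e ∈ Metric.ball (0 : EuclideanSpace ℝ (Fin 3)) R := by
      rw [mem_ball_zero_iff, hnorm, abs_of_pos hr.1]
      exact hr.2
    have h0 : r • e ≠ 0 := by
      rw [← norm_pos_iff, hnorm, abs_of_pos hr.1]
      exact hr.1
    have h1 := h _ hb
    rw [hlap _ hb h0, hnorm, abs_of_pos hr.1] at h1
    linarith
end
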